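/- arXiv:1407.5942 — 4 statements merged into one kernel-verified Lean document; each statement's English description precedes it below -/
import Mathlib

section
/- Let W : ℝ → ℝ be C³ with W'' > 0, let a, b be real constants, K > 0, c > 0, T > 0, and let u be a C³ solution of u_t = √(1+u_x²) W''(u_x) u_{xx} on [0,1]×[0,T] with Neumann boundary conditions u_x(0,t) = a, u_x(1,t) = b. Let u^m : [0,1]×[0,T] → ℝ be continuous with t ↦ ∫₀¹ |u_x(x,t) − u_x^m(x,t)|² dx continuous on [0,T], and suppose there is a partition 0 = τ_0 < τ_1 < … < τ_J = T such that on each open subinterval (τ_{j−1}, τ_j) the function u^m is a crystalline discrete solution with N ≤ c/m faces and auxiliary slopes s_0, s_{N+1}, satisfying: s_1 = a and s_N = b; |s_i| ≤ K and |s_{i+1} − s_i| ≤ m for 0 ≤ i ≤ N; for every 2 ≤ i ≤ N−1 with s_{i−1} ≠ s_{i+1}, s_i lies strictly between s_{i−1} and s_{i+1}; s_1 lies strictly between s_0 and s_2, and s_N lies strictly between s_{N−1} and s_{N+1}; and v_i = √(1+s_i²) Δ_i r_i / l_i for 1 ≤ i ≤ N, with r_i = 1 for 2 ≤ i ≤ N−1,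 r_1 = (s_2 − s_1)/(s_2 − s_0), r_N = (s_N − s_{N−1})/(s_{N+1} − s_{N−1}). Assume ‖u_x^m(·,0) − u_x(·,0)‖_{L∞([0,1])} ≤ m and u^m(0,0) = u(0,0). Then there exist m₀ > 0 and C_T > 0, depending only on u, W, K, c and T, such that if m ≤ m₀ then sup_{0 ≤ t ≤ T} ‖u(·,t) − u^m(·,t)‖_{H¹([0,1])} ≤ C_T m^{1/2}. -/
open Set MeasureTheory

/-- A crystalline discrete solution on a time interval `I`. -/
structure CrystSol (I : Set ℝ) where
  /-- number of faces -/
  N : ℕ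
  hN : 2 ≤ N
  /-- slopes of the faces -/
  s : ℕ → ℝ
  /-- corner positions -/
  x : ℕ → ℝ → ℝ
  /-- face velocities -/
  v : ℕ → ℝ → ℝ
  /-- the piecewise linear function `u^m` -/
  um : ℝ → ℝ → ℝ
  hs : ∀ i, 1 ≤ i → i + 1 ≤ N → s i ≠ s (i + 1)
  hx0 : ∀ t ∈ I, x 0 t = 0
  hxN : ∀ t ∈ I, x N t = 1
  hmono : ∀ t ∈ I, ∀ i, i + 1 ≤ N → x i t < x (i + 1) t
  hvC1 : ∀ i, 1 ≤ i → i ≤ N → ContDiffOn ℝ 1 (v i) I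
  hcorner : ∀ t ∈ I, ∀ i, 1 ≤ i → i + 1 ≤ N →
    HasDerivWithinAt (x i) (-((v (i + 1) t - v i t) / (s (i + 1) - s i))) I t
  haff : ∀ t ∈ I, ∀ i, 1 ≤ i → i ≤ N → ∀ ξ ∈ Icc (x (i - 1) t) (x i t),
    um ξ t = um (x (i - 1) t) t + s i * (ξ - x (i - 1) t)
  hvel : ∀ t ∈ I, ∀ i, 1 ≤ i → i ≤ N → ∀ ξ ∈ Ioo (x (i - 1) t) (x i t),
    HasDerivWithinAt (fun τ => um ξ τ) (v i t) I t

/-- The length of the (projection of the) `i`-th face. -/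
def CrystSol.len {I : Set ℝ} (S : CrystSol I) (i : ℕ) (t : ℝ) : ℝ :=
  S.x i t - S.x (i - 1) t

/-- The quantity `Δ_i`: the second divided difference of `W` at `s_{i-1}, s_i, s_{i+1}`. -/
noncomputable def secondDD (W : ℝ → ℝ) (s : ℕ → ℝ) (i : ℕ) : ℝ :=
  (W (s (i + 1)) - W (s i)) / (s (i + 1) - s i) -
    (W (s i) - W (s (i - 1))) / (s i - s (i - 1))


/-- A `C³` function `u` on `[0,1] × [0,T]` together with its relevant partial
derivatives `u_x`, `u_xx`, `u_xxx`, `u_t`, `u_xt`, all continuous. -/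
structure C3Sol (T : ℝ) where
  u : ℝ → ℝ → ℝ
  ux : ℝ → ℝ → ℝ
  uxx : ℝ → ℝ → ℝ
  uxxx : ℝ → ℝ → ℝ
  ut : ℝ → ℝ → ℝ
  uxt : ℝ → ℝ → ℝ
  hux : ∀ t ∈ Icc (0:ℝ) T, ∀ ξ ∈ Icc (0:ℝ) 1,
    HasDerivWithinAt (fun a => u a t) (ux ξ t) (Icc 0 1) ξ
  huxx : ∀ t ∈ Icc (0:ℝ) T, ∀ ξ ∈ Icc (0:ℝ) 1,
    HasDerivWithinAt (fun a => ux a t) (uxx ξ t) (Icc 0 1) ξ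
  huxxx : ∀ t ∈ Icc (0:ℝ) T, ∀ ξ ∈ Icc (0:ℝ) 1,
    HasDerivWithinAt (fun a => uxx a t) (uxxx ξ t) (Icc 0 1) ξ
  hut : ∀ ξ ∈ Icc (0:ℝ) 1, ∀ t ∈ Icc (0:ℝ) T,
    HasDerivWithinAt (fun τ => u ξ τ) (ut ξ t) (Icc 0 T) t
  huxt : ∀ ξ ∈ Icc (0:ℝ) 1, ∀ t ∈ Icc (0:ℝ) T,
    HasDerivWithinAt (fun τ => ux ξ τ) (uxt ξ t) (Icc 0 T) t
  hcont_u : ContinuousOn (fun q : ℝ × ℝ => u q.1 q.2) (Icc 0 1 ×ˢ Icc 0 T)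
  hcont_ux : ContinuousOn (fun q : ℝ × ℝ => ux q.1 q.2) (Icc 0 1 ×ˢ Icc 0 T)
  hcont_uxx : ContinuousOn (fun q : ℝ × ℝ => uxx q.1 q.2) (Icc 0 1 ×ˢ Icc 0 T)
  hcont_uxxx : ContinuousOn (fun q : ℝ × ℝ => uxxx q.1 q.2) (Icc 0 1 ×ˢ Icc 0 T)
  hcont_ut : ContinuousOn (fun q : ℝ × ℝ => ut q.1 q.2) (Icc 0 1 ×ˢ Icc 0 T)
  hcont_uxt : ContinuousOn (fun q : ℝ × ℝ => uxt q.1 q.2) (Icc 0 1 ×ˢ Icc 0 T)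

/-- `uxm` is the spatial derivative of the discrete solution: it equals the face slope
`s_i` on the interior of each face. -/
def SlopeLink {I : Set ℝ} (S : CrystSol I) (uxm : ℝ → ℝ → ℝ) : Prop :=
  ∀ t ∈ I, ∀ i, 1 ≤ i → i ≤ S.N →
    ∀ ξ ∈ Set.Ioo (S.x (i - 1) t) (S.x i t), uxm ξ t = S.s i

/-- `utm` is the time derivative of the discrete solution: it equals the face velocity
`v_i` on the interior of each face. -/
def VelLink {I : Set ℝ} (S : CrystSol I) (utm : ℝ → ℝ → ℝ) : Prop :=
  ∀ t ∈ I, ∀ i, 1 ≤ i → i ≤ S.N →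
    ∀ ξ ∈ Set.Ioo (S.x (i - 1) t) (S.x i t), utm ξ t = S.v i t

/-- The discrete solution `S` agrees with the global function `um` on `[0,1]`. -/
def UmLink {I : Set ℝ} (S : CrystSol I) (um : ℝ → ℝ → ℝ) : Prop :=
  ∀ t ∈ I, ∀ ξ ∈ Set.Icc (0:ℝ) 1, S.um ξ t = um ξ t

/-- Second-order Taylor expansion with Lagrange remainder, on either side of the base point. -/
lemma exists_taylor_two {W : ℝ → ℝ} (hW : ContDiff ℝ 3 W) {x y : ℝ} (hxy : x ≠ y) :
    ∃ η ∈ uIcc x y,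
      W y = W x + deriv W x * (y - x) + iteratedDeriv 2 W η * (y - x) ^ 2 / 2 := by
  have hW2 : ContDiff ℝ ((1 : ℕ) + 1) W := hW.of_le (by norm_num)
  obtain ⟨η, hη, h⟩ := taylor_mean_remainder_lagrange_iteratedDeriv (n := 1) hxy hW2.contDiffOn
  refine ⟨η, uIoo_subset_uIcc_self hη, ?_⟩
  rw [taylorWithinEval_succ, taylor_within_zero_eval, iteratedDerivWithin_one,
    DifferentiableAt.derivWithin (hW.differentiable (by norm_num) x)
      ((uniqueDiffOn_uIcc hxy) x left_mem_uIcc)] at h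
  norm_num [Nat.factorial] at h
  linarith

lemma exists_secondDD_eq {W : ℝ → ℝ} (hW : ContDiff ℝ 3 W) {K lam L m x y z : ℝ}
    (hlam : ∀ p, |p| ≤ K → lam ≤ iteratedDeriv 2 W p)
    (hL : ∀ p q, |p| ≤ K → |q| ≤ K → |iteratedDeriv 2 W p - iteratedDeriv 2 W q| ≤ L * |p - q|)
    (hL0 : 0 ≤ L) (hx : |x| ≤ K) (hy : |y| ≤ K) (hz : |z| ≤ K)
    (hxy : |y - x| ≤ m) (hyz : |z - y| ≤ m) (hbetween : y ∈ Ioo (min x z) (max x z)) :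
    ∃ ω, lam ≤ ω ∧ |ω - iteratedDeriv 2 W y| ≤ L * m ∧
      (W z - W y) / (z - y) - (W y - W x) / (y - x) = (z - x) / 2 * ω := by
  have hne : y ≠ x ∧ y ≠ z ∧ z ≠ x ∧ 0 < (z - y) / (z - x) ∧ (z - y) / (z - x) < 1 := by
    rcases lt_trichotomy x z with h | h | h
    · rw [min_eq_left h.le, max_eq_right h.le] at hbetween
      obtain ⟨h1, h2⟩ := hbetween
      refine ⟨h1.ne', h2.ne, h.ne', div_pos (by linarith) (by linarith), ?_⟩
      rw [div_lt_one (by linarith)]; linarith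
    · subst h
      simp only [min_self, max_self, Ioo_self, mem_empty_iff_false] at hbetween
    · rw [min_eq_right h.le, max_eq_left h.le] at hbetween
      obtain ⟨h1, h2⟩ := hbetween
      refine ⟨h2.ne, h1.ne', h.ne, div_pos_of_neg_of_neg (by linarith) (by linarith), ?_⟩
      rw [div_lt_one_of_neg (by linarith)]; linarith
  obtain ⟨h1, h2, h3, hθ0, hθ1⟩ := hne
  obtain ⟨η, hη, e1⟩ := exists_taylor_two hW h2
  obtain ⟨ζ, hζ, e2⟩ := exists_taylor_two hW h1
  have near : ∀ {w r : ℝ}, |w| ≤ K → |w - y| ≤ m → r ∈ uIcc y w → |r| ≤ K ∧ |r - y| ≤ m := by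
    intro w r hw hwm hr
    constructor
    · have : uIcc y w ⊆ Icc (-K) K := (ordConnected_Icc).uIcc_subset (abs_le.1 hy) (abs_le.1 hw)
      exact abs_le.2 (this hr)
    · exact (abs_sub_left_of_mem_uIcc hr).trans hwm
  obtain ⟨hη1, hη2⟩ := near hz hyz hη
  obtain ⟨hζ1, hζ2⟩ := near hx (by rwa [abs_sub_comm]) hζ
  have a1 := hlam _ hη1
  have a2 := hlam _ hζ1
  have b1 := (hL η y hη1 hy).trans (mul_le_mul_of_nonneg_left hη2 hL0)
  have b2 := (hL ζ y hζ1 hy).trans (mul_le_mul_of_nonneg_left hζ2 hL0)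
  set θ := (z - y) / (z - x) with hθ
  have hzx : z - x ≠ 0 := sub_ne_zero.2 h3
  refine ⟨θ * iteratedDeriv 2 W η + (1 - θ) * iteratedDeriv 2 W ζ, by nlinarith, ?_, ?_⟩
  · rw [abs_le] at *
    constructor <;> nlinarith
  · have h4 : z - y ≠ 0 := sub_ne_zero.2 h2.symm
    have h5 : y - x ≠ 0 := sub_ne_zero.2 h1
    rw [e1, e2, hθ]
    field_simp
    ring

lemma hasDerivAt_integral_of_continuousOn {f f' : ℝ → ℝ → ℝ} {T : ℝ}
    (hd : ∀ ξ ∈ Icc (0 : ℝ) 1, ∀ t ∈ Icc (0 : ℝ) T,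
      HasDerivWithinAt (fun τ => f ξ τ) (f' ξ t) (Icc 0 T) t)
    (hc : ContinuousOn (fun q : ℝ × ℝ => f q.1 q.2) (Icc 0 1 ×ˢ Icc 0 T))
    (hc' : ContinuousOn (fun q : ℝ × ℝ => f' q.1 q.2) (Icc 0 1 ×ˢ Icc 0 T))
    {t : ℝ} (ht : t ∈ Ioo 0 T) {y : ℝ} (hy : y ∈ Icc (0 : ℝ) 1) :
    HasDerivAt (fun τ => ∫ ξ in (0 : ℝ)..y, f ξ τ) (∫ ξ in (0 : ℝ)..y, f' ξ t) t := by
  have slice : ∀ {g : ℝ → ℝ → ℝ},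
      ContinuousOn (fun q : ℝ × ℝ => g q.1 q.2) (Icc 0 1 ×ˢ Icc 0 T) →
      ∀ τ ∈ Icc 0 T, ContinuousOn (fun ξ => g ξ τ) (Icc 0 y) := by
    intro g hg τ hτ
    refine hg.comp (f := fun ξ => (ξ, τ)) (by fun_prop) ?_
    intro ξ hξ
    exact ⟨⟨hξ.1, hξ.2.trans hy.2⟩, hτ⟩
  have int : ∀ {g : ℝ → ℝ → ℝ},
      ContinuousOn (fun q : ℝ × ℝ => g q.1 q.2) (Icc 0 1 ×ˢ Icc 0 T) →
      ∀ τ ∈ Icc 0 T, IntervalIntegrable (fun ξ => g ξ τ) volume 0 y := by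
    intro g hg τ hτ
    exact ContinuousOn.intervalIntegrable (by rw [uIcc_of_le hy.1]; exact slice hg τ hτ)
  obtain ⟨B, hB⟩ := (isCompact_Icc.prod isCompact_Icc).exists_bound_of_continuousOn hc'
  have hsub : ∀ ξ ∈ uIoc 0 y, ξ ∈ Icc (0 : ℝ) 1 := by
    intro ξ hξ
    rw [uIoc_of_le hy.1] at hξ
    exact ⟨hξ.1.le, hξ.2.trans hy.2⟩
  have htI := Ioo_subset_Icc_self ht
  refine (intervalIntegral.hasDerivAt_integral_of_dominated_loc_of_deriv_le
    (F := fun τ ξ => f ξ τ) (F' := fun τ ξ => f' ξ τ) (bound := fun _ => B)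
    (s := Ioo 0 T) (isOpen_Ioo.mem_nhds ht) ?_ (int hc t htI) ?_ ?_ ?_ ?_).2
  · filter_upwards [isOpen_Ioo.mem_nhds ht] with τ hτ
    exact (int hc τ (Ioo_subset_Icc_self hτ)).def'.aestronglyMeasurable
  · exact (int hc' t htI).def'.aestronglyMeasurable
  · refine Filter.Eventually.of_forall fun ξ hξ τ hτ => ?_
    exact hB (ξ, τ) ⟨hsub ξ hξ, Ioo_subset_Icc_self hτ⟩
  · exact intervalIntegrable_const
  · refine Filter.Eventually.of_forall fun ξ hξ τ hτ => ?_
    exact (hd ξ (hsub ξ hξ) τ (Ioo_subset_Icc_self hτ)).hasDerivAt (Icc_mem_nhds hτ.1 hτ.2)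

lemma partition_le {J : ℕ} {part : ℕ → ℝ} (hpart : ∀ j, j < J → part j < part (j + 1))
    {j k : ℕ} (hjk : j ≤ k) (hk : k ≤ J) : part j ≤ part k := by
  induction k, hjk using Nat.le_induction with
  | base => exact le_rfl
  | succ k _ ih => exact (ih (by omega)).trans (hpart k (by omega)).le

/-- A continuous function on `[0,T]` that is nonincreasing on every piece of a partition
stays below its initial value. -/
lemma le_initial_of_piecewise_deriv_nonpos {T : ℝ} {J : ℕ} {part : ℕ → ℝ} {f : ℝ → ℝ}
    (h0 : part 0 = 0) (hJ : part J = T) (hpart : ∀ j, j < J → part j < part (j + 1))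
    (hf : ContinuousOn f (Icc 0 T))
    (hd : ∀ j, j < J → ∀ t ∈ Ioo (part j) (part (j + 1)), ∃ f', HasDerivAt f f' t ∧ f' ≤ 0) :
    ∀ t ∈ Icc 0 T, f t ≤ f 0 := by
  have hanti : ∀ j, j < J → AntitoneOn f (Icc (part j) (part (j + 1))) := by
    intro j hj
    refine antitoneOn_of_deriv_nonpos (convex_Icc _ _) (hf.mono (Icc_subset_Icc ?_ ?_)) ?_ ?_
    · rw [← h0]; exact partition_le hpart (Nat.zero_le j) hj.le
    · rw [← hJ]; exact partition_le hpart hj le_rfl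
    · rw [interior_Icc]
      intro t ht
      obtain ⟨_, h, _⟩ := hd j hj t ht
      exact h.differentiableAt.differentiableWithinAt
    · rw [interior_Icc]
      intro t ht
      obtain ⟨_, h, hle⟩ := hd j hj t ht
      rwa [h.deriv]
  have key : ∀ j, j ≤ J → ∀ t ∈ Icc 0 (part j), f t ≤ f 0 := by
    intro j
    induction j with
    | zero =>
      intro _ t ht
      rw [h0] at ht
      rw [le_antisymm ht.2 ht.1]
    | succ j ih =>
      intro hj t ht
      rcases le_total t (part j) with h | h
      · exact ih (by omega) t ⟨ht.1, h⟩
      · have hlt := hpart j (by omega)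
        refine (hanti j (by omega) ⟨le_rfl, hlt.le⟩ ⟨h, ht.2⟩ h).trans ?_
        refine ih (by omega) (part j) ⟨?_, le_rfl⟩
        rw [← h0]; exact partition_le hpart (Nat.zero_le j) (by omega)
  intro t ht
  exact key J le_rfl t (by rwa [hJ])

lemma exists_mem_closure_piece {T : ℝ} {J : ℕ} {part : ℕ → ℝ}
    (h0 : part 0 = 0) (hJ : part J = T) (hJ1 : 1 ≤ J) {t : ℝ} (ht : t ∈ Icc 0 T) :
    ∃ j < J, t ∈ Icc (part j) (part (j + 1)) := by
  have key : ∀ j, 1 ≤ j → j ≤ J → t ≤ part j → ∃ i < j, t ∈ Icc (part i) (part (i + 1)) := by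
    intro j hj
    induction j, hj using Nat.le_induction with
    | base => intro _ h; exact ⟨0, by omega, by rw [h0]; exact ht.1, h⟩
    | succ j _ ih =>
      intro hjJ h
      rcases le_total t (part j) with h' | h'
      · obtain ⟨i, hi, hit⟩ := ih (by omega) h'
        exact ⟨i, by omega, hit⟩
      · exact ⟨j, by omega, h', h⟩
  exact key J hJ1 le_rfl (by rw [hJ]; exact ht.2)

/-- Half of the slope jump at the `k`-th corner, and zero at the two end points. -/
noncomputable def halfJump (N : ℕ) (s : ℕ → ℝ) (k : ℕ) : ℝ :=
  if k = 0 ∨ k = N then 0 else (s (k + 1) - s k) / 2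

/-- The mean of the values on both sides of the `k`-th corner, one-sided at the end points. -/
noncomputable def cornerMean (N : ℕ) (s : ℕ → ℝ) (k : ℕ) : ℝ :=
  if k = 0 then s 1 else if k = N then s N else (s k + s (k + 1)) / 2

lemma cornerMean_zero (N : ℕ) (s : ℕ → ℝ) : cornerMean N s 0 = s 1 := by simp [cornerMean]

lemma cornerMean_self {N : ℕ} (hN : 2 ≤ N) (s : ℕ → ℝ) : cornerMean N s N = s N := by
  simp [cornerMean, show N ≠ 0 by omega]

lemma cornerMean_eq_add {N k : ℕ} (hk : k < N) (s : ℕ → ℝ) :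
    cornerMean N s k = s (k + 1) - halfJump N s k := by
  unfold cornerMean halfJump
  rcases Nat.eq_zero_or_pos k with rfl | h
  · simp
  · simp only [h.ne', hk.ne, if_false, or_self]; ring

lemma cornerMean_succ_eq (N k : ℕ) (s : ℕ → ℝ) :
    cornerMean N s (k + 1) = s (k + 1) + halfJump N s (k + 1) := by
  unfold cornerMean halfJump
  by_cases h : k + 1 = N
  · simp [h, show N ≠ 0 by omega]
  · simp only [h, Nat.succ_ne_zero, if_false, or_self]; ring

lemma abs_halfJump_le {N : ℕ} {s : ℕ → ℝ} {m : ℝ} (hm : 0 ≤ m)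
    (h : ∀ i ≤ N, |s (i + 1) - s i| ≤ m) {k : ℕ} (hk : k ≤ N) : |halfJump N s k| ≤ m / 2 := by
  unfold halfJump
  split_ifs
  · rw [abs_zero]; positivity
  · rw [abs_div, abs_two]
    linarith [h k hk]

/-- Summation by parts for the dissipation of the slope energy. -/
lemma sum_slope_energy_eq {N : ℕ} (hN : 2 ≤ N) (s v x' p w : ℕ → ℝ)
    (h0 : x' 0 = 0) (h1 : x' N = 0)
    (hx' : ∀ k, 1 ≤ k → k < N → x' k * (s (k + 1) - s k) = -(v (k + 1) - v k))
    (hp0 : p 0 = s 1) (hpN : p N = s N) :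
    ∑ k ∈ Finset.range N, (-2 * s (k + 1) *
        ((w (k + 1) + p (k + 1) * x' (k + 1)) - (w k + p k * x' k)) +
          s (k + 1) ^ 2 * (x' (k + 1) - x' k)) =
      -2 * (s N * w N - s 1 * w 0) +
      ∑ k ∈ Finset.range N, (2 * v (k + 1) *
        (p (k + 1) - p k - (halfJump N s (k + 1) + halfJump N s k)) +
          2 * (halfJump N s (k + 1) * w (k + 1) + halfJump N s k * w k)) := by
  have hjump : ∀ k ≤ N, halfJump N v k = -(halfJump N s k * x' k) := by
    intro k hk
    unfold halfJump
    split_ifs with h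
    · simp
    · push Not at h
      linarith [hx' k (by omega) (by omega)]
  set σ := cornerMean N s with hσ
  set ω := cornerMean N v with hω
  set g : ℕ → ℝ := fun k => 2 * ω k * (p k - σ k) + 2 * σ k * w k
    - (-2 * σ k * p k + σ k ^ 2 + halfJump N s k ^ 2) * x' k with hg
  have hgN : g N = 2 * (s N * w N) := by
    simp only [hg, hσ, cornerMean_self hN, hpN, h1]; ring
  have hg0 : g 0 = 2 * (s 1 * w 0) := by
    simp only [hg, hσ, cornerMean_zero, hp0, h0]; ring
  have hterm : ∀ k ∈ Finset.range N, (-2 * s (k + 1) *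
        ((w (k + 1) + p (k + 1) * x' (k + 1)) - (w k + p k * x' k)) +
          s (k + 1) ^ 2 * (x' (k + 1) - x' k)) =
        (2 * v (k + 1) *
        (p (k + 1) - p k - (halfJump N s (k + 1) + halfJump N s k)) +
          2 * (halfJump N s (k + 1) * w (k + 1) + halfJump N s k * w k)) - (g (k + 1) - g k) := by
    intro k hk
    have hk := Finset.mem_range.1 hk
    simp only [hg, hσ, hω, cornerMean_succ_eq, cornerMean_eq_add hk, hjump k hk.le,
      hjump (k + 1) hk]
    ring
  rw [Finset.sum_congr rfl hterm, Finset.sum_sub_distrib, Finset.sum_range_sub, hgN, hg0]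
  ring

lemma face_pointwise_bound {X P Q v d μ lam B e U r m C : ℝ} (hlam : 0 < lam) (hμ : lam ≤ μ)
    (hX : |X| ≤ B) (hU : U = P * X) (hv : v = μ * d) (hP : |P - Q| ≤ e) (hQ : |μ - Q| ≤ r)
    (hC : C ≤ 2 * d * U + m) :
    2 * v * X - 2 * v * d + C - 2 * X * U ≤ B ^ 2 / lam * (e ^ 2 + r ^ 2) + m := by
  have hPμ : (P - μ) ^ 2 ≤ 2 * (e ^ 2 + r ^ 2) := by
    have h1 := sq_le_sq' (abs_le.1 hP).1 (abs_le.1 hP).2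
    have h2 := sq_le_sq' (abs_le.1 hQ).1 (abs_le.1 hQ).2
    nlinarith [sq_nonneg ((P - Q) + (μ - Q))]
  have hX2 : X ^ 2 ≤ B ^ 2 := sq_le_sq' (abs_le.1 hX).1 (abs_le.1 hX).2
  have hμ0 : 0 < μ := hlam.trans_le hμ
  have hmain : -2 * (X - d) * (P * X - μ * d) ≤ (P - μ) ^ 2 * X ^ 2 / (2 * lam) := by
    rw [le_div_iff₀ (by positivity)]
    have h1 : -2 * (X - d) * (P * X - μ * d) ≤
        -2 * lam * (X - d) ^ 2 - 2 * (P - μ) * X * (X - d) := by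
      nlinarith [mul_nonneg (sub_nonneg.2 hμ) (sq_nonneg (X - d))]
    have h2 := mul_le_mul_of_nonneg_right h1 (show 0 ≤ 2 * lam by positivity)
    nlinarith [sq_nonneg (2 * lam * (X - d) + (P - μ) * X)]
  have h3 : (P - μ) ^ 2 * X ^ 2 / (2 * lam) ≤ B ^ 2 / lam * (e ^ 2 + r ^ 2) := by
    rw [div_mul_eq_mul_div, div_le_div_iff₀ (by positivity) hlam]
    have := mul_le_mul hPμ hX2 (sq_nonneg _) (by positivity)
    nlinarith
  subst hU hv
  linarith [show 2 * (μ * d) * X - 2 * (μ * d) * d + 2 * d * (P * X) - 2 * X * (P * X) =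
    -2 * (X - d) * (P * X - μ * d) by ring]

lemma face_integral_bound {M p X U : ℝ → ℝ} {x₀ x₁ s v μ α₀ α₁ lam B L Q m : ℝ}
    (hx : x₀ < x₁) (hp : ContinuousOn p (Icc x₀ x₁)) (hXc : ContinuousOn X (Icc x₀ x₁))
    (hUc : ContinuousOn U (Icc x₀ x₁)) (hpX : ∫ ξ in x₀..x₁, X ξ = p x₁ - p x₀)
    (hB : 0 ≤ B) (hUlip : ∀ ξ ∈ Icc x₀ x₁, ∀ ζ ∈ Icc x₀ x₁, |U ξ - U ζ| ≤ B * |ξ - ζ|)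
    (hU : ∀ ξ ∈ Icc x₀ x₁, U ξ = M (p ξ) * X ξ) (hXB : ∀ ξ ∈ Icc x₀ x₁, |X ξ| ≤ B)
    (hM : ∀ ξ ∈ Icc x₀ x₁, |M (p ξ) - M s| ≤ L * |p ξ - s|) (hμM : |μ - M s| ≤ Q * m)
    (hlam : 0 < lam) (hμ : lam ≤ μ) (hv : v * (x₁ - x₀) = μ * (α₁ + α₀))
    (hα₀ : |α₀| ≤ m / 2) (hα₁ : |α₁| ≤ m / 2) :
    2 * v * (p x₁ - p x₀ - (α₁ + α₀)) + 2 * (α₁ * U x₁ + α₀ * U x₀)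
        - 2 * ∫ ξ in x₀..x₁, X ξ * U ξ ≤
      B ^ 2 / lam * L ^ 2 * (∫ ξ in x₀..x₁, (p ξ - s) ^ 2)
        + (B ^ 2 / lam * (Q * m) ^ 2 + 2 * m * B) * (x₁ - x₀) := by
  have hl : 0 < x₁ - x₀ := sub_pos.2 hx
  set l := x₁ - x₀ with hl_def
  set d := (α₁ + α₀) / l with hd
  have hdl : d * l = α₁ + α₀ := by rw [hd]; field_simp
  have hvd : v = μ * d := by
    rw [hd, ← mul_div_assoc, ← hv]; field_simp
  set c := 2 / l * (α₁ * U x₁ + α₀ * U x₀) with hc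
  have hcl : c * l = 2 * (α₁ * U x₁ + α₀ * U x₀) := by rw [hc]; field_simp
  have hu : uIcc x₀ x₁ = Icc x₀ x₁ := uIcc_of_le hx.le
  have iX : IntervalIntegrable X volume x₀ x₁ := ContinuousOn.intervalIntegrable (by rwa [hu])
  have iXU : IntervalIntegrable (fun ξ => X ξ * U ξ) volume x₀ x₁ :=
    ContinuousOn.intervalIntegrable (by rw [hu]; exact hXc.mul hUc)
  have ips : IntervalIntegrable (fun ξ => (p ξ - s) ^ 2) volume x₀ x₁ :=
    ContinuousOn.intervalIntegrable (by rw [hu]; exact (hp.sub continuousOn_const).pow 2)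
  have hmono : ∫ ξ in x₀..x₁, (2 * v * X ξ + (c - 2 * v * d) - 2 * (X ξ * U ξ)) ≤
      ∫ ξ in x₀..x₁, (B ^ 2 / lam * L ^ 2 * (p ξ - s) ^ 2
        + (B ^ 2 / lam * (Q * m) ^ 2 + 2 * m * B)) := by
    refine intervalIntegral.integral_mono_on hx.le
      (((iX.const_mul _).add intervalIntegrable_const).sub (iXU.const_mul _))
      ((ips.const_mul _).add intervalIntegrable_const) ?_
    intro ξ hξ
    have hξl : ∀ ζ ∈ Icc x₀ x₁, |U ζ - U ξ| ≤ B * l := by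
      intro ζ hζ
      refine (hUlip ζ hζ ξ hξ).trans (mul_le_mul_of_nonneg_left ?_ hB)
      rw [abs_le]; constructor <;> linarith [hξ.1, hξ.2, hζ.1, hζ.2]
    have hU1 := hξl x₁ (right_mem_Icc.2 hx.le)
    have hU0 := hξl x₀ (left_mem_Icc.2 hx.le)
    have hcb : c ≤ 2 * d * U ξ + 2 * m * B := by
      have e1 : α₁ * (U x₁ - U ξ) ≤ m / 2 * (B * l) := by
        refine (le_abs_self _).trans ?_
        rw [abs_mul]
        exact mul_le_mul hα₁ hU1 (abs_nonneg _) ((abs_nonneg _).trans hα₁)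
      have e0 : α₀ * (U x₀ - U ξ) ≤ m / 2 * (B * l) := by
        refine (le_abs_self _).trans ?_
        rw [abs_mul]
        exact mul_le_mul hα₀ hU0 (abs_nonneg _) ((abs_nonneg _).trans hα₀)
      refine le_of_mul_le_mul_right ?_ hl
      rw [hcl, show (2 * d * U ξ + 2 * m * B) * l = 2 * (d * l) * U ξ + 2 * m * B * l by ring, hdl]
      linarith
    have := face_pointwise_bound hlam hμ (hXB ξ hξ) (hU ξ hξ) hvd (hM ξ hξ) hμM hcb
    rw [mul_pow, sq_abs] at this
    linarith
  rw [intervalIntegral.integral_sub ((iX.const_mul _).add intervalIntegrable_const)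
    (iXU.const_mul _), intervalIntegral.integral_add (iX.const_mul _) intervalIntegrable_const,
    intervalIntegral.integral_add (ips.const_mul _) intervalIntegrable_const,
    intervalIntegral.integral_const_mul, intervalIntegral.integral_const_mul,
    intervalIntegral.integral_const_mul, intervalIntegral.integral_const,
    intervalIntegral.integral_const, hpX, smul_eq_mul, smul_eq_mul, ← hl_def] at hmono
  have e : l * (c - 2 * v * d) = c * l - 2 * v * (d * l) := by ring
  rw [e, hcl, hdl] at hmono
  linarith

namespace C3Sol

variable {T : ℝ} (H : C3Sol T)

lemma continuousOn_slice {f : ℝ → ℝ → ℝ}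
    (hf : ContinuousOn (fun q : ℝ × ℝ => f q.1 q.2) (Icc 0 1 ×ˢ Icc 0 T))
    {t : ℝ} (ht : t ∈ Icc 0 T) : ContinuousOn (fun ξ => f ξ t) (Icc 0 1) :=
  hf.comp (f := fun ξ => (ξ, t)) (by fun_prop) fun _ hξ => ⟨hξ, ht⟩

lemma intervalIntegrable_slice {f : ℝ → ℝ → ℝ}
    (hf : ContinuousOn (fun q : ℝ × ℝ => f q.1 q.2) (Icc 0 1 ×ˢ Icc 0 T))
    {t : ℝ} (ht : t ∈ Icc 0 T) {x y : ℝ} (hx : x ∈ Icc (0 : ℝ) 1) (hy : y ∈ Icc (0 : ℝ) 1) :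
    IntervalIntegrable (fun ξ => f ξ t) volume x y :=
  ((continuousOn_slice hf ht).mono (ordConnected_Icc.uIcc_subset hx hy)).intervalIntegrable

lemma integral_deriv_slice {f f' : ℝ → ℝ} (hd : ∀ ξ ∈ Icc (0 : ℝ) 1,
    HasDerivWithinAt f (f' ξ) (Icc 0 1) ξ) (hf' : ContinuousOn f' (Icc 0 1)) {x y : ℝ}
    (hx : x ∈ Icc (0 : ℝ) 1) (hy : y ∈ Icc (0 : ℝ) 1) :
    ∫ ξ in x..y, f' ξ = f y - f x := by
  wlog hxy : x ≤ y generalizing x y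
  · rw [intervalIntegral.integral_symm, this hy hx (le_of_not_ge hxy), neg_sub]
  have hsub : Icc x y ⊆ Icc 0 1 := Icc_subset_Icc hx.1 hy.2
  refine intervalIntegral.integral_eq_sub_of_hasDerivAt_of_le hxy
    (fun ξ hξ => ((hd ξ (hsub hξ)).continuousWithinAt).mono hsub) ?_
    (hf'.mono (by rwa [uIcc_of_le hxy])).intervalIntegrable
  intro ξ hξ
  exact (hd ξ (hsub (Ioo_subset_Icc_self hξ))).hasDerivAt
    (Icc_mem_nhds (hx.1.trans_lt hξ.1) (hξ.2.trans_le hy.2))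

lemma hasDerivAt_along {X : ℝ → ℝ} {X' t : ℝ} (ht : t ∈ Ioo 0 T) (hX : HasDerivAt X X' t)
    (hmem : ∀ᶠ τ in nhds t, X τ ∈ Icc (0 : ℝ) 1) :
    HasDerivAt (fun τ => H.u (X τ) τ) (H.ut (X t) t + H.ux (X t) t * X') t := by
  have hXt : X t ∈ Icc (0 : ℝ) 1 := hmem.self_of_nhds
  have htI := Ioo_subset_Icc_self ht
  have h1 : HasDerivAt (fun τ => H.u (X t) τ) (H.ut (X t) t) t :=
    (H.hut _ hXt _ htI).hasDerivAt (Icc_mem_nhds ht.1 ht.2)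
  have h2 : HasDerivAt (fun τ => H.u (X τ) τ - H.u (X t) τ - H.ux (X t) t * (X τ - X t)) 0 t := by
    rw [hasDerivAt_iff_isLittleO]
    simp only [sub_self, mul_zero, sub_zero, smul_zero]
    refine Asymptotics.IsLittleO.trans_isBigO (g := fun τ => X τ - X t) ?_ hX.isBigO_sub
    rw [Asymptotics.isLittleO_iff]
    intro ε hε
    have hc := H.hcont_ux (X t, t) ⟨hXt, htI⟩
    obtain ⟨δ, hδ, hδ'⟩ := Metric.continuousWithinAt_iff.1 hc ε hε
    filter_upwards [hmem, isOpen_Ioo.mem_nhds ht, Metric.ball_mem_nhds t hδ,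
      hX.continuousAt.preimage_mem_nhds (Metric.ball_mem_nhds (X t) hδ)] with τ m1 m2 m3 m4
    have hτI := Ioo_subset_Icc_self m2
    have hsub : uIcc (X t) (X τ) ⊆ Icc 0 1 := ordConnected_Icc.uIcc_subset hXt m1
    have hball : uIcc (X t) (X τ) ⊆ Metric.ball (X t) δ :=
      ((convex_ball (X t) δ).ordConnected).uIcc_subset (Metric.mem_ball_self hδ) m4
    have := (convex_uIcc (X t) (X τ)).norm_image_sub_le_of_norm_hasDerivWithin_le
      (f := fun ξ => H.u ξ τ - H.ux (X t) t * ξ) (f' := fun ξ => H.ux ξ τ - H.ux (X t) t)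
      (C := ε) ?_ ?_ left_mem_uIcc right_mem_uIcc
    · refine le_trans (le_of_eq ?_) this
      congr 1; ring
    · intro ξ hξ
      refine ((H.hux τ hτI ξ (hsub hξ)).mono hsub).fun_sub ?_
      simpa using ((hasDerivAt_id' ξ).const_mul (H.ux (X t) t)).hasDerivWithinAt
    · intro ξ hξ
      refine (hδ' (x := (ξ, τ)) ⟨hsub hξ, hτI⟩ ?_).le
      rw [Prod.dist_eq]
      exact max_lt (hball hξ) m3
  have h3 : HasDerivAt (fun τ => H.ux (X t) t * (X τ - X t)) (H.ux (X t) t * X') t :=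
    (hX.sub_const _).const_mul _
  refine (((h1.add h2).add h3).congr_deriv (by ring)).congr_of_eventuallyEq
    (Filter.Eventually.of_forall fun τ => ?_)
  simp only [Pi.add_apply]
  ring

lemma ut_sub_eq_integral {t : ℝ} (ht : t ∈ Ioo 0 T) {x y : ℝ} (hx : x ∈ Icc (0 : ℝ) 1)
    (hy : y ∈ Icc (0 : ℝ) 1) : ∫ ξ in x..y, H.uxt ξ t = H.ut y t - H.ut x t := by
  have htI := Ioo_subset_Icc_self ht
  have h0 : (0 : ℝ) ∈ Icc (0 : ℝ) 1 := ⟨le_rfl, zero_le_one⟩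
  have key : ∀ z ∈ Icc (0 : ℝ) 1, ∫ ξ in (0 : ℝ)..z, H.uxt ξ t = H.ut z t - H.ut 0 t := by
    intro z hz
    have d1 := hasDerivAt_integral_of_continuousOn H.huxt H.hcont_ux H.hcont_uxt ht hz
    have d2 : HasDerivAt (fun τ => H.u z τ - H.u 0 τ) (H.ut z t - H.ut 0 t) t :=
      ((H.hut z hz t htI).hasDerivAt (Icc_mem_nhds ht.1 ht.2)).sub
        ((H.hut 0 h0 t htI).hasDerivAt (Icc_mem_nhds ht.1 ht.2))
    refine d1.unique (d2.congr_of_eventuallyEq ?_)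
    filter_upwards [isOpen_Ioo.mem_nhds ht] with τ hτ
    have hτI := Ioo_subset_Icc_self hτ
    exact integral_deriv_slice (H.hux τ hτI) (continuousOn_slice H.hcont_ux hτI) h0 hz
  have i := fun {x y : ℝ} => intervalIntegrable_slice (x := x) (y := y) H.hcont_uxt htI
  rw [← intervalIntegral.integral_interval_sub_left (i h0 hy) (i h0 hx), key y hy, key x hx]
  ring

lemma abs_ut_sub_le {t B : ℝ} (ht : t ∈ Ioo 0 T)
    (hB : ∀ ξ ∈ Icc (0 : ℝ) 1, |H.uxt ξ t| ≤ B) {x y : ℝ} (hx : x ∈ Icc (0 : ℝ) 1)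
    (hy : y ∈ Icc (0 : ℝ) 1) : |H.ut y t - H.ut x t| ≤ B * |y - x| := by
  rw [← H.ut_sub_eq_integral ht hx hy]
  exact intervalIntegral.norm_integral_le_of_norm_le_const (f := fun ξ => H.uxt ξ t) fun ξ hξ =>
    hB ξ (ordConnected_Icc.uIcc_subset hx hy (uIoc_subset_uIcc hξ))

lemma integral_ux_mul_uxt {t : ℝ} (ht : t ∈ Ioo 0 T) :
    ∫ ξ in (0 : ℝ)..1, H.ux ξ t * H.uxt ξ t =
      H.ux 1 t * H.ut 1 t - H.ux 0 t * H.ut 0 t - ∫ ξ in (0 : ℝ)..1, H.uxx ξ t * H.ut ξ t := by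
  have htI := Ioo_subset_Icc_self ht
  have h0 : (0 : ℝ) ∈ Icc (0 : ℝ) 1 := ⟨le_rfl, zero_le_one⟩
  have h1 : (1 : ℝ) ∈ Icc (0 : ℝ) 1 := ⟨zero_le_one, le_rfl⟩
  have hu : uIcc (0 : ℝ) 1 = Icc 0 1 := uIcc_of_le zero_le_one
  refine intervalIntegral.integral_mul_deriv_eq_deriv_mul_of_hasDeriv_right
    (by rw [hu]; exact continuousOn_slice H.hcont_ux htI)
    (by rw [hu]; exact continuousOn_slice H.hcont_ut htI) ?_ ?_
    (intervalIntegrable_slice H.hcont_uxx htI h0 h1)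
    (intervalIntegrable_slice H.hcont_uxt htI h0 h1)
  · intro ξ hξ
    rw [min_eq_left zero_le_one, max_eq_right zero_le_one] at hξ
    exact ((H.huxx t htI ξ (Ioo_subset_Icc_self hξ)).hasDerivAt
      (Icc_mem_nhds hξ.1 hξ.2)).hasDerivWithinAt
  · intro ξ hξ
    rw [min_eq_left zero_le_one, max_eq_right zero_le_one] at hξ
    have hξI := Ioo_subset_Icc_self hξ
    have hc := continuousOn_slice H.hcont_uxt htI
    have d : HasDerivAt (fun z => ∫ η in (0 : ℝ)..z, H.uxt η t) (H.uxt ξ t) ξ :=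
      intervalIntegral.integral_hasDerivAt_right
        (intervalIntegrable_slice H.hcont_uxt htI h0 hξI)
        ((hc.mono Ioo_subset_Icc_self).stronglyMeasurableAtFilter isOpen_Ioo ξ hξ)
        (hc.continuousAt (Icc_mem_nhds hξ.1 hξ.2))
    refine (HasDerivAt.congr_of_eventuallyEq (d.const_add (H.ut 0 t)) ?_).hasDerivWithinAt
    filter_upwards [isOpen_Ioo.mem_nhds hξ] with z hz
    rw [H.ut_sub_eq_integral ht h0 (Ioo_subset_Icc_self hz)]
    ring

end C3Sol

lemma sq_integral_le_integral_sq {g : ℝ → ℝ} {x y : ℝ} (hx : 0 ≤ x) (hxy : x ≤ y) (hy : y ≤ 1)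
    (hg : IntervalIntegrable g volume 0 1)
    (hg2 : IntervalIntegrable (fun ξ => g ξ ^ 2) volume 0 1) :
    (∫ ξ in x..y, g ξ) ^ 2 ≤ ∫ ξ in (0 : ℝ)..1, g ξ ^ 2 := by
  have hsub : uIcc x y ⊆ uIcc 0 1 := by
    rw [uIcc_of_le hxy, uIcc_of_le zero_le_one]; exact Icc_subset_Icc hx hy
  have ig := hg.mono_set hsub
  have ig2 := hg2.mono_set hsub
  have h1 : ∫ ξ in x..y, g ξ ^ 2 ≤ ∫ ξ in (0 : ℝ)..1, g ξ ^ 2 :=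
    intervalIntegral.integral_mono_interval hx hxy hy
      (Filter.Eventually.of_forall fun ξ => sq_nonneg _) hg2
  set G := ∫ ξ in x..y, g ξ with hG
  have h2 : 0 ≤ ∫ ξ in x..y, (g ξ ^ 2 - 2 * G * g ξ + G ^ 2) :=
    intervalIntegral.integral_nonneg hxy fun ξ _ => by nlinarith [sq_nonneg (g ξ - G)]
  rw [intervalIntegral.integral_add (ig2.sub (ig.const_mul _)) intervalIntegrable_const,
    intervalIntegral.integral_sub ig2 (ig.const_mul _), intervalIntegral.integral_const_mul,
    intervalIntegral.integral_const, smul_eq_mul, ← hG] at h2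
  nlinarith [sq_nonneg G]

lemma integral_affine (c s a b : ℝ) :
    ∫ ξ in a..b, (c + s * (ξ - a)) = c * (b - a) + s / 2 * (b - a) ^ 2 := by
  rw [intervalIntegral.integral_add intervalIntegrable_const
    (Continuous.intervalIntegrable (by fun_prop) _ _), intervalIntegral.integral_const_mul,
    intervalIntegral.integral_sub (Continuous.intervalIntegrable (by fun_prop) _ _)
    intervalIntegrable_const, integral_id, intervalIntegral.integral_const,
    intervalIntegral.integral_const, smul_eq_mul, smul_eq_mul]
  ring

/-- The trapezoidal-type sum produced by the face velocities approximates `∫ M` between the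
boundary slopes. -/
lemma abs_sum_mul_jump_sub_integral_le {M : ℝ → ℝ} (hMc : Continuous M) {N : ℕ} (hN : 2 ≤ N)
    {s μ : ℕ → ℝ} {R L Q m c : ℝ} (hL0 : 0 ≤ L) (hm : 0 < m) (hNc : (N : ℝ) ≤ c / m)
    (hL : ∀ p q, |p| ≤ R → |q| ≤ R → |M p - M q| ≤ L * |p - q|) (hQ0 : 0 ≤ Q)
    (hs : ∀ i ≤ N + 1, |s i| ≤ R) (hjump : ∀ i ≤ N, |s (i + 1) - s i| ≤ m)
    (hμ : ∀ k < N, |μ k - M (s (k + 1))| ≤ Q * m) :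
    |∑ k ∈ Finset.range N, μ k * (halfJump N s (k + 1) + halfJump N s k)
      - ∫ p in (s 1)..(s N), M p| ≤ c * (Q + L) * m := by
  have hint : ∑ k ∈ Finset.range N, ∫ p in (cornerMean N s k)..(cornerMean N s (k + 1)), M p =
      ∫ p in (s 1)..(s N), M p := by
    rw [intervalIntegral.sum_integral_adjacent_intervals
      fun k _ => hMc.intervalIntegrable _ _, cornerMean_zero, cornerMean_self hN]
  rw [← hint, ← Finset.sum_sub_distrib]
  have hterm : ∀ k ∈ Finset.range N, |μ k * (halfJump N s (k + 1) + halfJump N s k)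
      - ∫ p in (cornerMean N s k)..(cornerMean N s (k + 1)), M p| ≤ (Q + L) * m * m := by
    intro k hk
    have hk := Finset.mem_range.1 hk
    have a0 := abs_halfJump_le hm.le hjump hk.le
    have a1 := abs_halfJump_le hm.le hjump (k := k + 1) hk
    have hσ0 := cornerMean_eq_add hk s
    have hσ1 := cornerMean_succ_eq N k s
    have hmemR : ∀ j ≤ N, cornerMean N s j ∈ Icc (-R) R := by
      intro j hj
      have h1 := abs_le.1 (hs 1 (by omega))
      have h2 := abs_le.1 (hs N (by omega))
      have h3 := abs_le.1 (hs j (by omega))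
      have h4 := abs_le.1 (hs (j + 1) (by omega))
      unfold cornerMean
      split_ifs
      · exact h1
      · exact h2
      · constructor <;> linarith
    set σ₀ := cornerMean N s k
    set σ₁ := cornerMean N s (k + 1)
    have hD : halfJump N s (k + 1) + halfJump N s k = σ₁ - σ₀ := by linarith
    have hDm : |σ₁ - σ₀| ≤ m := by
      rw [← hD]
      exact (abs_add_le _ _).trans (by linarith)
    have hI : |∫ p in σ₀..σ₁, (μ k - M p)| ≤ (Q * m + L * m) * |σ₁ - σ₀| := by
      rw [← Real.norm_eq_abs]
      refine intervalIntegral.norm_integral_le_of_norm_le_const fun p hp => ?_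
      have hp := uIoc_subset_uIcc hp
      have hpR : |p| ≤ R :=
        abs_le.2 (ordConnected_Icc.uIcc_subset (hmemR k hk.le) (hmemR (k + 1) hk) hp)
      have hps : |s (k + 1) - p| ≤ m := by
        have : uIcc σ₀ σ₁ ⊆ Icc (s (k + 1) - m / 2) (s (k + 1) + m / 2) := by
          rw [abs_le] at a0 a1
          exact ordConnected_Icc.uIcc_subset ⟨by linarith, by linarith⟩ ⟨by linarith, by linarith⟩
        have := this hp
        rw [abs_le]; constructor <;> linarith [this.1, this.2]
      have e1 := hL (s (k + 1)) p (hs _ (by omega)) hpR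
      have e2 := mul_le_mul_of_nonneg_left hps hL0
      calc ‖μ k - M p‖ = |(μ k - M (s (k + 1))) + (M (s (k + 1)) - M p)| := by
            rw [Real.norm_eq_abs]; congr 1; ring
        _ ≤ Q * m + L * m := (abs_add_le _ _).trans (add_le_add (hμ k hk) (e1.trans e2))
    rw [intervalIntegral.integral_sub intervalIntegrable_const (hMc.intervalIntegrable _ _),
      intervalIntegral.integral_const, smul_eq_mul] at hI
    rw [hD, mul_comm]
    refine hI.trans ?_
    rw [← add_mul]
    exact mul_le_mul_of_nonneg_left hDm (by positivity)
  refine (Finset.abs_sum_le_sum_abs _ _).trans ((Finset.sum_le_sum hterm).trans ?_)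
  rw [Finset.sum_const, Finset.card_range, nsmul_eq_mul]
  rw [le_div_iff₀ hm] at hNc
  nlinarith [mul_le_mul_of_nonneg_right hNc (show 0 ≤ (Q + L) * m by positivity)]

namespace CrystSol

variable {I : Set ℝ} (S : CrystSol I)

lemma x_le {t : ℝ} (ht : t ∈ I) {k l : ℕ} (hkl : k ≤ l) (hl : l ≤ S.N) : S.x k t ≤ S.x l t := by
  induction l, hkl using Nat.le_induction with
  | base => exact le_rfl
  | succ l _ ih => exact (ih (by omega)).trans (S.hmono t ht l hl).le

lemma x_mem {t : ℝ} (ht : t ∈ I) {k : ℕ} (hk : k ≤ S.N) : S.x k t ∈ Icc (0 : ℝ) 1 :=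
  ⟨S.hx0 t ht ▸ S.x_le ht (Nat.zero_le k) hk, S.hxN t ht ▸ S.x_le ht hk le_rfl⟩

lemma face_subset {t : ℝ} (ht : t ∈ I) {k : ℕ} (hk : k < S.N) :
    Icc (S.x k t) (S.x (k + 1) t) ⊆ Icc 0 1 :=
  Icc_subset_Icc (S.x_mem ht hk.le).1 (S.x_mem ht hk).2

lemma exists_face {t : ℝ} (ht : t ∈ I) {ξ : ℝ} (hξ : ξ ∈ Ioo (0 : ℝ) 1)
    (hne : ξ ∉ (fun k => S.x k t) '' (Set.univ : Set ℕ)) :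
    ∃ k < S.N, ξ ∈ Ioo (S.x k t) (S.x (k + 1) t) := by
  have key : ∀ j, j ≤ S.N → ξ < S.x j t → ∃ k < j, ξ ∈ Ioo (S.x k t) (S.x (k + 1) t) := by
    intro j
    induction j with
    | zero => intro _ h; rw [S.hx0 t ht] at h; exact absurd hξ.1 h.not_gt
    | succ j ih =>
      intro hj h
      rcases lt_trichotomy ξ (S.x j t) with h' | h' | h'
      · obtain ⟨k, hk, hk'⟩ := ih (by omega) h'
        exact ⟨k, by omega, hk'⟩
      · exact absurd ⟨j, mem_univ _, h'.symm⟩ hne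
      · exact ⟨j, by omega, h', h⟩
  exact key S.N le_rfl (by rw [S.hxN t ht]; exact hξ.2)

lemma sum_integral_faces {t : ℝ} (ht : t ∈ I) {f : ℝ → ℝ}
    (hf : ∀ k < S.N, IntervalIntegrable f volume (S.x k t) (S.x (k + 1) t)) :
    ∑ k ∈ Finset.range S.N, ∫ ξ in (S.x k t)..(S.x (k + 1) t), f ξ = ∫ ξ in (0 : ℝ)..1, f ξ := by
  rw [intervalIntegral.sum_integral_adjacent_intervals (a := fun k => S.x k t) hf]
  simp only [S.hx0 t ht, S.hxN t ht]

lemma intervalIntegrable_face {t : ℝ} (ht : t ∈ I) {f : ℝ → ℝ} (hf : ContinuousOn f (Icc 0 1))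
    {k : ℕ} (hk : k < S.N) : IntervalIntegrable f volume (S.x k t) (S.x (k + 1) t) := by
  refine ContinuousOn.intervalIntegrable ?_
  rw [uIcc_of_le (S.hmono t ht k hk).le]
  exact hf.mono (S.face_subset ht hk)

/-- Integrals involving the piecewise constant slope split over the faces. -/
lemma integral_comp_slope {uxm : ℝ → ℝ → ℝ} (hlink : SlopeLink S uxm) {t : ℝ} (ht : t ∈ I)
    {g : ℝ → ℝ → ℝ} (hg : ∀ y, ContinuousOn (fun ξ => g ξ y) (Icc 0 1)) :
    IntervalIntegrable (fun ξ => g ξ (uxm ξ t)) volume 0 1 ∧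
    ∫ ξ in (0 : ℝ)..1, g ξ (uxm ξ t) =
      ∑ k ∈ Finset.range S.N, ∫ ξ in (S.x k t)..(S.x (k + 1) t), g ξ (S.s (k + 1)) := by
  have hEq : ∀ k < S.N, EqOn (fun ξ => g ξ (S.s (k + 1))) (fun ξ => g ξ (uxm ξ t))
      (uIoo (S.x k t) (S.x (k + 1) t)) := by
    intro k hk ξ hξ
    rw [uIoo_of_le (S.hmono t ht k hk).le] at hξ
    simp only [hlink t ht (k + 1) (by omega) hk ξ hξ]
  have hi : ∀ k < S.N, IntervalIntegrable (fun ξ => g ξ (uxm ξ t)) volume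
      (S.x k t) (S.x (k + 1) t) := fun k hk =>
    (S.intervalIntegrable_face ht (hg _) hk).congr_uIoo (hEq k hk)
  refine ⟨?_, ?_⟩
  · have := IntervalIntegrable.trans_iterate (a := fun k => S.x k t) hi
    simpa only [S.hx0 t ht, S.hxN t ht] using this
  · rw [← S.sum_integral_faces ht hi]
    refine Finset.sum_congr rfl fun k hk => ?_
    exact (intervalIntegral.integral_congr_uIoo (hEq k (Finset.mem_range.1 hk))).symm

/-- The velocity of the `k`-th corner, zero at the two fixed end points. -/
noncomputable def cornerVel (k : ℕ) (t : ℝ) : ℝ :=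
  if k = 0 ∨ k = S.N then 0 else -((S.v (k + 1) t - S.v k t) / (S.s (k + 1) - S.s k))

lemma hasDerivAt_x (hI : IsOpen I) {t : ℝ} (ht : t ∈ I) {k : ℕ} (hk : k ≤ S.N) :
    HasDerivAt (S.x k) (S.cornerVel k t) t := by
  unfold cornerVel
  split_ifs with h
  · rcases h with rfl | rfl
    · refine (hasDerivAt_const t (0 : ℝ)).congr_of_eventuallyEq ?_
      filter_upwards [hI.mem_nhds ht] with τ hτ using S.hx0 τ hτ
    · refine (hasDerivAt_const t (1 : ℝ)).congr_of_eventuallyEq ?_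
      filter_upwards [hI.mem_nhds ht] with τ hτ using S.hxN τ hτ
  · push Not at h
    exact (S.hcorner t ht k (by omega) (by omega)).hasDerivAt (hI.mem_nhds ht)

lemma um_eq {t : ℝ} (ht : t ∈ I) {k : ℕ} (hk : k < S.N) {ξ : ℝ}
    (hξ : ξ ∈ Icc (S.x k t) (S.x (k + 1) t)) :
    S.um ξ t = S.um (S.x k t) t + S.s (k + 1) * (ξ - S.x k t) :=
  S.haff t ht (k + 1) (by omega) hk ξ hξ

lemma hasDerivAt_um_corner (hI : IsOpen I) {t : ℝ} (ht : t ∈ I) {k : ℕ} (hk : k < S.N) :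
    HasDerivAt (fun τ => S.um (S.x k τ) τ)
      (S.v (k + 1) t + S.s (k + 1) * S.cornerVel k t) t := by
  obtain ⟨y, hy⟩ := exists_between (S.hmono t ht k hk)
  have d1 := (S.hvel t ht (k + 1) (by omega) hk y hy).hasDerivAt (hI.mem_nhds ht)
  have d2 := (((S.hasDerivAt_x hI ht hk.le).sub_const y).const_mul (S.s (k + 1)))
  refine (d1.add d2).congr_of_eventuallyEq ?_
  filter_upwards [hI.mem_nhds ht,
    (S.hasDerivAt_x hI ht hk.le).continuousAt.preimage_mem_nhds (Iio_mem_nhds hy.1),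
    (S.hasDerivAt_x hI ht hk).continuousAt.preimage_mem_nhds (Ioi_mem_nhds hy.2)] with τ h1 h2 h3
  have := S.um_eq h1 hk (ξ := y) ⟨le_of_lt h2, le_of_lt h3⟩
  simp only [Pi.add_apply]
  linarith

/-- The rate of change of the mean of the discrete solution. -/
lemma hasDerivAt_integral_um (hI : IsOpen I) {t : ℝ} (ht : t ∈ I) :
    HasDerivAt (fun τ => ∫ ξ in (0 : ℝ)..1, S.um ξ τ)
      (∑ k ∈ Finset.range S.N, S.v (k + 1) t * (S.x (k + 1) t - S.x k t)) t := by
  have hform : ∀ τ ∈ I, ∫ ξ in (0 : ℝ)..1, S.um ξ τ = ∑ k ∈ Finset.range S.N,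
      (S.um (S.x k τ) τ * (S.x (k + 1) τ - S.x k τ)
        + S.s (k + 1) / 2 * (S.x (k + 1) τ - S.x k τ) ^ 2) := by
    intro τ hτ
    have hEq : ∀ k < S.N, EqOn
        (fun ξ => S.um (S.x k τ) τ + S.s (k + 1) * (ξ - S.x k τ)) (fun ξ => S.um ξ τ)
        (uIcc (S.x k τ) (S.x (k + 1) τ)) := by
      intro k hk ξ hξ
      rw [uIcc_of_le (S.hmono τ hτ k hk).le] at hξ
      exact (S.um_eq hτ hk hξ).symm
    rw [← S.sum_integral_faces hτ fun k hk => ContinuousOn.intervalIntegrable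
      ((show Continuous fun ξ => S.um (S.x k τ) τ + S.s (k + 1) * (ξ - S.x k τ) by
        fun_prop).continuousOn.congr fun ξ hξ => (hEq k hk hξ).symm)]
    refine Finset.sum_congr rfl fun k hk => ?_
    rw [← intervalIntegral.integral_congr (hEq k (Finset.mem_range.1 hk)),
      integral_affine]
  have hd : HasDerivAt (fun τ => ∑ k ∈ Finset.range S.N,
      (S.um (S.x k τ) τ * (S.x (k + 1) τ - S.x k τ)
        + S.s (k + 1) / 2 * (S.x (k + 1) τ - S.x k τ) ^ 2))
      (∑ k ∈ Finset.range S.N, (S.v (k + 1) t * (S.x (k + 1) t - S.x k t)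
        + (S.um (S.x (k + 1) t) t * S.cornerVel (k + 1) t
          - S.um (S.x k t) t * S.cornerVel k t))) t := by
    refine HasDerivAt.fun_sum fun k hk => ?_
    have hk := Finset.mem_range.1 hk
    have dl := (S.hasDerivAt_x hI ht (k := k + 1) hk).fun_sub (S.hasDerivAt_x hI ht hk.le)
    refine (((S.hasDerivAt_um_corner hI ht hk).fun_mul dl).fun_add
      ((dl.fun_pow 2).const_mul (S.s (k + 1) / 2))).congr_deriv ?_
    rw [S.um_eq ht hk (right_mem_Icc.2 (S.hmono t ht k hk).le)]
    push_cast
    ring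
  rw [Finset.sum_add_distrib, Finset.sum_range_sub
    (fun k => S.um (S.x k t) t * S.cornerVel k t)] at hd
  have z0 : S.cornerVel 0 t = 0 := by simp [cornerVel]
  have zN : S.cornerVel S.N t = 0 := by simp [cornerVel]
  rw [z0, zN, mul_zero, mul_zero, sub_zero, add_zero] at hd
  refine hd.congr_of_eventuallyEq ?_
  filter_upwards [hI.mem_nhds ht] with τ hτ using hform τ hτ

lemma hasDerivAt_um_space {t : ℝ} (ht : t ∈ I) {k : ℕ} (hk : k < S.N) {ξ : ℝ}
    (hξ : ξ ∈ Ioo (S.x k t) (S.x (k + 1) t)) :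
    HasDerivAt (fun η => S.um η t) (S.s (k + 1)) ξ := by
  have d : HasDerivAt (fun η => S.um (S.x k t) t + S.s (k + 1) * (η - S.x k t))
      (S.s (k + 1)) ξ := by
    simpa using (((hasDerivAt_id' ξ).sub_const (S.x k t)).const_mul (S.s (k + 1))).const_add
      (S.um (S.x k t) t)
  refine d.congr_of_eventuallyEq ?_
  filter_upwards [isOpen_Ioo.mem_nhds hξ] with η hη
  exact S.um_eq ht hk (Ioo_subset_Icc_self hη)

section Comparison

variable {T : ℝ} (H : C3Sol T) {uxm : ℝ → ℝ → ℝ}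

lemma sq_sub_le_slope_energy (hlink : SlopeLink S uxm) {t : ℝ} (ht : t ∈ I) (htT : t ∈ Icc 0 T)
    (hc : ContinuousOn (fun ξ => S.um ξ t) (Icc 0 1)) {x y : ℝ}
    (hx : x ∈ Icc (0 : ℝ) 1) (hy : y ∈ Icc (0 : ℝ) 1) :
    ((H.u y t - S.um y t) - (H.u x t - S.um x t)) ^ 2 ≤
      ∫ ξ in (0 : ℝ)..1, (H.ux ξ t - uxm ξ t) ^ 2 := by
  wlog hxy : x ≤ y generalizing x y
  · rw [← neg_sub, neg_sq]
    exact this hy hx (le_of_not_ge hxy)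
  have hux := C3Sol.continuousOn_slice H.hcont_ux htT
  have i1 := (S.integral_comp_slope hlink ht (g := fun ξ y => H.ux ξ t - y)
    fun y => hux.sub continuousOn_const).1
  have i2 := (S.integral_comp_slope hlink ht (g := fun ξ y => (H.ux ξ t - y) ^ 2)
    fun y => (hux.sub continuousOn_const).pow 2).1
  have hsub : Icc x y ⊆ Icc 0 1 := Icc_subset_Icc hx.1 hy.2
  rw [← integral_eq_of_hasDerivAt_off_countable_of_le (fun ξ => H.u ξ t - S.um ξ t)
    (fun ξ => H.ux ξ t - uxm ξ t) hxy (s := (fun k => S.x k t) '' univ)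
    ((countable_univ).image _)
    (((C3Sol.continuousOn_slice H.hcont_u htT).sub hc).mono hsub) ?_
    (i1.mono_set (by rwa [uIcc_of_le hxy, uIcc_of_le zero_le_one]))]
  · exact sq_integral_le_integral_sq hx.1 hxy hy.2 i1 i2
  · rintro ξ ⟨hξ, hne⟩
    have hξ01 : ξ ∈ Ioo (0 : ℝ) 1 := ⟨hx.1.trans_lt hξ.1, hξ.2.trans_le hy.2⟩
    obtain ⟨k, hk, hface⟩ := S.exists_face ht hξ01 hne
    rw [hlink t ht (k + 1) (by omega) hk ξ hface]
    exact ((H.hux t htT ξ (Ioo_subset_Icc_self hξ01)).hasDerivAt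
      (Icc_mem_nhds hξ01.1 hξ01.2)).fun_sub (S.hasDerivAt_um_space ht hk hface)

lemma hasDerivAt_slope_energy (hI : IsOpen I) (hIT : I ⊆ Ioo 0 T) (hlink : SlopeLink S uxm)
    {t : ℝ} (ht : t ∈ I) (hs1 : H.ux 0 t = S.s 1) (hsN : H.ux 1 t = S.s S.N) :
    HasDerivAt (fun τ => ∫ ξ in (0 : ℝ)..1, (H.ux ξ τ - uxm ξ τ) ^ 2)
      (∑ k ∈ Finset.range S.N, (2 * S.v (k + 1) t *
        (H.ux (S.x (k + 1) t) t - H.ux (S.x k t) t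
          - (halfJump S.N S.s (k + 1) + halfJump S.N S.s k)) +
        2 * (halfJump S.N S.s (k + 1) * H.ut (S.x (k + 1) t) t
          + halfJump S.N S.s k * H.ut (S.x k t) t)
        - 2 * ∫ ξ in (S.x k t)..(S.x (k + 1) t), H.uxx ξ t * H.ut ξ t)) t := by
  have h0 : (0 : ℝ) ∈ Icc (0 : ℝ) 1 := ⟨le_rfl, zero_le_one⟩
  have h1 : (1 : ℝ) ∈ Icc (0 : ℝ) 1 := ⟨zero_le_one, le_rfl⟩
  have htT := hIT ht
  have htI := Ioo_subset_Icc_self htT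
  have hform : ∀ τ ∈ I, ∫ ξ in (0 : ℝ)..1, (H.ux ξ τ - uxm ξ τ) ^ 2 =
      (∫ ξ in (0 : ℝ)..1, H.ux ξ τ ^ 2) + ∑ k ∈ Finset.range S.N,
        (-2 * S.s (k + 1) * (H.u (S.x (k + 1) τ) τ - H.u (S.x k τ) τ)
          + S.s (k + 1) ^ 2 * (S.x (k + 1) τ - S.x k τ)) := by
    intro τ hτ
    have hτI := Ioo_subset_Icc_self (hIT hτ)
    have hux := C3Sol.continuousOn_slice H.hcont_ux hτI
    rw [(S.integral_comp_slope hlink hτ (g := fun ξ y => (H.ux ξ τ - y) ^ 2)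
      fun y => (hux.sub continuousOn_const).pow 2).2,
      ← S.sum_integral_faces hτ (f := fun ξ => H.ux ξ τ ^ 2)
        fun k hk => S.intervalIntegrable_face hτ (hux.pow 2) hk, ← Finset.sum_add_distrib]
    refine Finset.sum_congr rfl fun k hk => ?_
    have hk := Finset.mem_range.1 hk
    have i1 := S.intervalIntegrable_face hτ hux hk
    have i2 := S.intervalIntegrable_face hτ (f := fun ξ => H.ux ξ τ ^ 2) (hux.pow 2) hk
    have e : ∀ ξ, (H.ux ξ τ - S.s (k + 1)) ^ 2 =
        H.ux ξ τ ^ 2 + (-2 * S.s (k + 1) * H.ux ξ τ + S.s (k + 1) ^ 2) := fun ξ => by ring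
    simp only [e]
    rw [intervalIntegral.integral_add i2 ((i1.const_mul _).add intervalIntegrable_const),
      intervalIntegral.integral_add (i1.const_mul _) intervalIntegrable_const,
      intervalIntegral.integral_const_mul, intervalIntegral.integral_const, smul_eq_mul,
      C3Sol.integral_deriv_slice (H.hux τ hτI) hux (S.x_mem hτ hk.le) (S.x_mem hτ hk),
      mul_comm (S.x (k + 1) τ - S.x k τ)]
  have d1 : HasDerivAt (fun τ => ∫ ξ in (0 : ℝ)..1, H.ux ξ τ ^ 2)
      (2 * ∫ ξ in (0 : ℝ)..1, H.ux ξ t * H.uxt ξ t) t := by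
    have := hasDerivAt_integral_of_continuousOn (f := fun ξ τ => H.ux ξ τ ^ 2)
      (f' := fun ξ τ => 2 * (H.ux ξ τ * H.uxt ξ τ)) (T := T)
      (fun ξ hξ τ hτ => ((H.huxt ξ hξ τ hτ).fun_pow 2).congr_deriv (by push_cast; ring))
      (H.hcont_ux.pow 2) ((H.hcont_ux.mul H.hcont_uxt).const_mul 2) htT h1
    rwa [intervalIntegral.integral_const_mul] at this
  have d2 : HasDerivAt (fun τ => ∑ k ∈ Finset.range S.N,
        (-2 * S.s (k + 1) * (H.u (S.x (k + 1) τ) τ - H.u (S.x k τ) τ)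
          + S.s (k + 1) ^ 2 * (S.x (k + 1) τ - S.x k τ)))
      (∑ k ∈ Finset.range S.N, (-2 * S.s (k + 1) *
        ((H.ut (S.x (k + 1) t) t + H.ux (S.x (k + 1) t) t * S.cornerVel (k + 1) t)
          - (H.ut (S.x k t) t + H.ux (S.x k t) t * S.cornerVel k t)) +
          S.s (k + 1) ^ 2 * (S.cornerVel (k + 1) t - S.cornerVel k t))) t := by
    have du : ∀ k ≤ S.N, HasDerivAt (fun τ => H.u (S.x k τ) τ)
        (H.ut (S.x k t) t + H.ux (S.x k t) t * S.cornerVel k t) t := by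
      intro k hk
      refine H.hasDerivAt_along htT (S.hasDerivAt_x hI ht hk) ?_
      filter_upwards [hI.mem_nhds ht] with τ hτ using S.x_mem hτ hk
    refine HasDerivAt.fun_sum fun k hk => ?_
    have hk := Finset.mem_range.1 hk
    exact (((du (k + 1) hk).fun_sub (du k hk.le)).const_mul _).fun_add
      (((S.hasDerivAt_x hI ht (k := k + 1) hk).fun_sub (S.hasDerivAt_x hI ht hk.le)).const_mul _)
  have hsum := sum_slope_energy_eq S.hN S.s (fun k => S.v k t) (fun k => S.cornerVel k t)
    (fun k => H.ux (S.x k t) t) (fun k => H.ut (S.x k t) t) (by simp [cornerVel])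
    (by simp [cornerVel]) ?_ (by simp only [S.hx0 t ht, hs1]) (by simp only [S.hxN t ht, hsN])
  · have hcont : ContinuousOn (fun ξ => H.uxx ξ t * H.ut ξ t) (Icc 0 1) :=
      (C3Sol.continuousOn_slice H.hcont_uxx htI).mul (C3Sol.continuousOn_slice H.hcont_ut htI)
    refine ((d1.fun_add d2).congr_of_eventuallyEq ?_).congr_deriv ?_
    · filter_upwards [hI.mem_nhds ht] with τ hτ using hform τ hτ
    · rw [hsum, H.integral_ux_mul_uxt htT, Finset.sum_sub_distrib, ← Finset.mul_sum,
        S.sum_integral_faces ht fun k hk => S.intervalIntegrable_face ht hcont hk]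
      simp only [S.hx0 t ht, S.hxN t ht, hs1, hsN]
      ring
  · intro k hk1 hkN
    have hne : S.s (k + 1) - S.s k ≠ 0 := sub_ne_zero.2 (S.hs k hk1 hkN).symm
    simp only [cornerVel, show ¬(k = 0 ∨ k = S.N) by omega, if_false]
    field_simp

end Comparison

end CrystSol

lemma exists_lipschitz_bound {f : ℝ → ℝ} (hf : ContDiff ℝ 1 f) (R : ℝ) :
    ∃ L, 0 ≤ L ∧ ∀ p q, |p| ≤ R → |q| ≤ R → |f p - f q| ≤ L * |p - q| := by
  obtain ⟨L, hL⟩ := (isCompact_Icc (a := -R) (b := R)).exists_bound_of_continuousOn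
    (hf.continuous_deriv le_rfl).continuousOn
  refine ⟨max L 0, le_max_right _ _, fun p q hp hq => ?_⟩
  exact (convex_Icc (-R) R).norm_image_sub_le_of_norm_deriv_le
    (fun x _ => hf.differentiable one_ne_zero x) (fun x hx => (hL x hx).trans (le_max_left _ _))
    (abs_le.1 hq) (abs_le.1 hp)

lemma continuousOn_integral_of_continuousOn {f : ℝ → ℝ → ℝ} {T : ℝ}
    (hc : ContinuousOn (fun q : ℝ × ℝ => f q.1 q.2) (Icc 0 1 ×ˢ Icc 0 T)) :
    ContinuousOn (fun t => ∫ ξ in (0 : ℝ)..1, f ξ t) (Icc 0 T) := by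
  obtain ⟨B, hB⟩ := (isCompact_Icc.prod isCompact_Icc).exists_bound_of_continuousOn hc
  have hmem : ∀ ξ ∈ uIoc (0 : ℝ) 1, ξ ∈ Icc (0 : ℝ) 1 := fun ξ hξ => by
    rw [uIoc_of_le zero_le_one] at hξ
    exact Ioc_subset_Icc_self hξ
  intro t ht
  refine intervalIntegral.continuousWithinAt_of_dominated_interval (bound := fun _ => B) ?_ ?_
    intervalIntegrable_const ?_
  · filter_upwards [self_mem_nhdsWithin] with τ hτ
    exact (C3Sol.intervalIntegrable_slice hc hτ ⟨le_rfl, zero_le_one⟩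
      ⟨zero_le_one, le_rfl⟩).def'.aestronglyMeasurable
  · filter_upwards [self_mem_nhdsWithin] with τ hτ
    exact Filter.Eventually.of_forall fun ξ hξ => hB (ξ, τ) ⟨hmem ξ hξ, hτ⟩
  · refine Filter.Eventually.of_forall fun ξ hξ => ?_
    exact (hc (ξ, t) ⟨hmem ξ hξ, ht⟩).comp (f := fun τ => (ξ, τ)) (by fun_prop)
      fun τ hτ => ⟨hmem ξ hξ, hτ⟩

/-- The mobility `√(1 + p²) W''(p)` of the equation. -/
noncomputable def mobility (W : ℝ → ℝ) (p : ℝ) : ℝ := Real.sqrt (1 + p ^ 2) * iteratedDeriv 2 W p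

lemma contDiff_iteratedDeriv_two {W : ℝ → ℝ} (hW : ContDiff ℝ 3 W) :
    ContDiff ℝ 1 (iteratedDeriv 2 W) := by
  rw [iteratedDeriv_eq_iterate]
  exact ContDiff.iterate_deriv' 1 2 hW

lemma contDiff_mobility {W : ℝ → ℝ} (hW : ContDiff ℝ 3 W) : ContDiff ℝ 1 (mobility W) := by
  refine ContDiff.mul (ContDiff.sqrt (by fun_prop) fun p => ?_) (contDiff_iteratedDeriv_two hW)
  positivity

lemma C3Sol.integral_ut {T : ℝ} (H : C3Sol T) {M : ℝ → ℝ} (hM : Continuous M) {t : ℝ}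
    (ht : t ∈ Icc 0 T) (hpde : ∀ ξ ∈ Icc (0 : ℝ) 1, H.ut ξ t = M (H.ux ξ t) * H.uxx ξ t) :
    ∫ ξ in (0 : ℝ)..1, H.ut ξ t = ∫ p in (H.ux 0 t)..(H.ux 1 t), M p := by
  have hu : uIcc (0 : ℝ) 1 = Icc 0 1 := uIcc_of_le zero_le_one
  rw [← intervalIntegral.integral_comp_mul_deriv'' (f := fun ξ => H.ux ξ t)
    (f' := fun ξ => H.uxx ξ t) (g := M)
    (by rw [hu]; exact C3Sol.continuousOn_slice H.hcont_ux ht) ?_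
    (by rw [hu]; exact C3Sol.continuousOn_slice H.hcont_uxx ht) hM.continuousOn]
  · refine intervalIntegral.integral_congr fun ξ hξ => ?_
    rw [hu] at hξ
    exact hpde ξ hξ
  · intro ξ hξ
    rw [min_eq_left zero_le_one, max_eq_right zero_le_one] at hξ
    exact ((H.huxx t ht ξ (Ioo_subset_Icc_self hξ)).hasDerivAt
      (Icc_mem_nhds hξ.1 hξ.2)).hasDerivWithinAt

/-- The factor multiplying the velocity of the first and the last face. -/
noncomputable def boundaryFactor (N : ℕ) (s : ℕ → ℝ) (i : ℕ) : ℝ :=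
  if i = 1 then (s 2 - s 1) / (s 2 - s 0)
  else if i = N then (s N - s (N - 1)) / (s (N + 1) - s (N - 1)) else 1

lemma sub_ne_zero_of_mem_Ioo_min_max {x y z : ℝ} (h : y ∈ Ioo (min x z) (max x z)) :
    z - x ≠ 0 := by
  intro hz
  rw [sub_eq_zero.1 hz, min_self, max_self, Ioo_self] at h
  exact h

lemma exists_secondDD_mul_boundaryFactor_eq {W : ℝ → ℝ} (hW : ContDiff ℝ 3 W) {N : ℕ} (hN : 2 ≤ N)
    {s : ℕ → ℝ} {K lam L m : ℝ} (hm : 0 < m)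
    (hlam : ∀ p, |p| ≤ K → lam ≤ iteratedDeriv 2 W p)
    (hL : ∀ p q, |p| ≤ K → |q| ≤ K → |iteratedDeriv 2 W p - iteratedDeriv 2 W q| ≤ L * |p - q|)
    (hL0 : 0 ≤ L) (hs : ∀ i ≤ N + 1, |s i| ≤ K) (hjump : ∀ i ≤ N, |s (i + 1) - s i| ≤ m)
    (hmono : ∀ i, 2 ≤ i → i ≤ N - 1 → s (i - 1) ≠ s (i + 1) →
      s i ∈ Ioo (min (s (i - 1)) (s (i + 1))) (max (s (i - 1)) (s (i + 1))))
    (hfirst : s 1 ∈ Ioo (min (s 0) (s 2)) (max (s 0) (s 2)))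
    (hlast : s N ∈ Ioo (min (s (N - 1)) (s (N + 1))) (max (s (N - 1)) (s (N + 1))))
    {k : ℕ} (hk : k < N) :
    ∃ ω, lam ≤ ω ∧ |ω - iteratedDeriv 2 W (s (k + 1))| ≤ L * m ∧
      secondDD W s (k + 1) * boundaryFactor N s (k + 1) =
        (halfJump N s (k + 1) + halfJump N s k) * ω := by
  have dd : s (k + 1) ∈ Ioo (min (s k) (s (k + 2))) (max (s k) (s (k + 2))) →
      ∃ ω, lam ≤ ω ∧ |ω - iteratedDeriv 2 W (s (k + 1))| ≤ L * m ∧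
        secondDD W s (k + 1) = (s (k + 2) - s k) / 2 * ω := fun h =>
    exists_secondDD_eq hW hlam hL hL0 (hs k (by omega)) (hs (k + 1) (by omega))
      (hs (k + 2) (by omega)) (hjump k hk.le) (hjump (k + 1) hk) h
  by_cases h1 : k = 0
  · subst h1
    obtain ⟨ω, hω, hω', e⟩ := dd hfirst
    refine ⟨ω, hω, hω', ?_⟩
    have hne := sub_ne_zero_of_mem_Ioo_min_max hfirst
    rw [e]
    simp only [boundaryFactor, halfJump, zero_add, true_or, if_true, one_ne_zero, false_or,
      show ¬(1 = N) by omega, if_false, add_zero, one_add_one_eq_two]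
    field_simp
  by_cases h2 : k + 1 = N
  · subst h2
    simp only [Nat.add_sub_cancel] at hlast
    obtain ⟨ω, hω, hω', e⟩ := dd hlast
    refine ⟨ω, hω, hω', ?_⟩
    have hne := sub_ne_zero_of_mem_Ioo_min_max hlast
    rw [e]
    simp only [boundaryFactor, halfJump, h1, or_true, if_true, false_or, Nat.add_eq_right,
      show ¬(k = k + 1) by omega, if_false, zero_add, Nat.add_sub_cancel]
    field_simp
  · have hr : boundaryFactor N s (k + 1) = 1 := by
      simp [boundaryFactor, h1, h2]
    have hD : halfJump N s (k + 1) + halfJump N s k = (s (k + 2) - s k) / 2 := by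
      simp only [halfJump, h1, h2, hk.ne, Nat.succ_ne_zero, or_self, if_false]
      ring
    rw [hr, hD, mul_one]
    by_cases h3 : s k = s (k + 2)
    · refine ⟨iteratedDeriv 2 W (s (k + 1)), hlam _ (hs _ (by omega)), ?_, ?_⟩
      · rw [sub_self, abs_zero]; positivity
      · simp only [secondDD, Nat.add_sub_cancel]
        rw [show s (k + 1 + 1) = s k from h3.symm, ← neg_sub (s (k + 1)) (s k),
          ← neg_sub (W (s (k + 1))) (W (s k)), neg_div_neg_eq, h3]
        ring
    · exact dd (hmono (k + 1) (by omega) (by omega) h3)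

lemma abs_mobility_coeff_sub_le {W : ℝ → ℝ} {K L m ω p : ℝ} (hp : |p| ≤ K)
    (hω : |ω - iteratedDeriv 2 W p| ≤ L * m) :
    |Real.sqrt (1 + p ^ 2) * ω - mobility W p| ≤ Real.sqrt (1 + K ^ 2) * L * m := by
  rw [mobility, ← mul_sub, abs_mul, abs_of_nonneg (Real.sqrt_nonneg _), mul_assoc]
  refine mul_le_mul (Real.sqrt_le_sqrt ?_) hω (abs_nonneg _) (Real.sqrt_nonneg _)
  linarith [sq_le_sq' (abs_le.1 hp).1 (abs_le.1 hp).2]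

lemma le_sqrt_one_add_sq_mul {lam ω p : ℝ} (hlam : 0 < lam) (hω : lam ≤ ω) :
    lam ≤ Real.sqrt (1 + p ^ 2) * ω := by
  have : 1 ≤ Real.sqrt (1 + p ^ 2) := Real.one_le_sqrt.2 (by nlinarith [sq_nonneg p])
  nlinarith

namespace CrystSol

variable {I : Set ℝ} (S : CrystSol I) {T : ℝ} (H : C3Sol T) {uxm : ℝ → ℝ → ℝ}

lemma exists_slope_energy_deriv_le {M : ℝ → ℝ} {μ : ℕ → ℝ} {B R L Q lam m : ℝ}
    (hI : IsOpen I) (hIT : I ⊆ Ioo 0 T) (hlink : SlopeLink S uxm)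
    {t : ℝ} (ht : t ∈ I) (hs1 : H.ux 0 t = S.s 1) (hsN : H.ux 1 t = S.s S.N)
    (hpde : ∀ ξ ∈ Icc (0 : ℝ) 1, H.ut ξ t = M (H.ux ξ t) * H.uxx ξ t)
    (hB : 0 ≤ B) (hux : ∀ ξ ∈ Icc (0 : ℝ) 1, |H.ux ξ t| ≤ R)
    (huxx : ∀ ξ ∈ Icc (0 : ℝ) 1, |H.uxx ξ t| ≤ B) (huxt : ∀ ξ ∈ Icc (0 : ℝ) 1, |H.uxt ξ t| ≤ B)
    (hL : ∀ p q, |p| ≤ R → |q| ≤ R → |M p - M q| ≤ L * |p - q|)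
    (hs : ∀ i ≤ S.N + 1, |S.s i| ≤ R) (hjump : ∀ i ≤ S.N, |S.s (i + 1) - S.s i| ≤ m)
    (hlam : 0 < lam) (hm : 0 < m) (hm1 : m ≤ 1)
    (hμ : ∀ k < S.N, lam ≤ μ k) (hμM : ∀ k < S.N, |μ k - M (S.s (k + 1))| ≤ Q * m)
    (hv : ∀ k < S.N, S.v (k + 1) t * (S.x (k + 1) t - S.x k t) =
      μ k * (halfJump S.N S.s (k + 1) + halfJump S.N S.s k)) :
    ∃ F', HasDerivAt (fun τ => ∫ ξ in (0 : ℝ)..1, (H.ux ξ τ - uxm ξ τ) ^ 2) F' t ∧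
      F' ≤ B ^ 2 / lam * L ^ 2 * (∫ ξ in (0 : ℝ)..1, (H.ux ξ t - uxm ξ t) ^ 2)
        + (B ^ 2 / lam * Q ^ 2 + 2 * B) * m := by
  refine ⟨_, S.hasDerivAt_slope_energy H hI hIT hlink ht hs1 hsN, ?_⟩
  have htI := Ioo_subset_Icc_self (hIT ht)
  have cux := C3Sol.continuousOn_slice H.hcont_ux htI
  have cuxx := C3Sol.continuousOn_slice H.hcont_uxx htI
  have cut := C3Sol.continuousOn_slice H.hcont_ut htI
  have hface := fun k (hk : k ∈ Finset.range S.N) => by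
    have hk := Finset.mem_range.1 hk
    have hsub := S.face_subset ht hk
    exact face_integral_bound (M := M) (p := fun ξ => H.ux ξ t) (X := fun ξ => H.uxx ξ t)
      (U := fun ξ => H.ut ξ t) (s := S.s (k + 1)) (S.hmono t ht k hk) (cux.mono hsub)
      (cuxx.mono hsub) (cut.mono hsub)
      (C3Sol.integral_deriv_slice (H.huxx t htI) cuxx (S.x_mem ht hk.le) (S.x_mem ht hk)) hB
      (fun ξ hξ ζ hζ => H.abs_ut_sub_le (hIT ht) huxt (hsub hζ) (hsub hξ))
      (fun ξ hξ => hpde ξ (hsub hξ)) (fun ξ hξ => huxx ξ (hsub hξ))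
      (fun ξ hξ => hL _ _ (hux ξ (hsub hξ)) (hs _ (by omega))) (hμM k hk) hlam (hμ k hk)
      (hv k hk) (abs_halfJump_le hm.le hjump hk.le) (abs_halfJump_le hm.le hjump hk)
  refine (Finset.sum_le_sum hface).trans ?_
  rw [Finset.sum_add_distrib, ← Finset.mul_sum, ← Finset.mul_sum,
    Finset.sum_range_sub (fun k => S.x k t), S.hx0 t ht, S.hxN t ht,
    (S.integral_comp_slope hlink ht (g := fun ξ y => (H.ux ξ t - y) ^ 2)
      fun y => (cux.sub continuousOn_const).pow 2).2]
  have hmm : m ^ 2 ≤ m := by nlinarith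
  have := mul_le_mul_of_nonneg_left hmm (show 0 ≤ B ^ 2 / lam * Q ^ 2 by positivity)
  rw [mul_pow]
  linarith

lemma exists_mean_deriv_le {M : ℝ → ℝ} {um : ℝ → ℝ → ℝ} {μ : ℕ → ℝ} {R L Q m c : ℝ}
    (hM : Continuous M) (hI : IsOpen I) (hIT : I ⊆ Ioo 0 T) (hlink : UmLink S um)
    (hum : ContinuousOn (fun q : ℝ × ℝ => um q.1 q.2) (Icc 0 1 ×ˢ Icc 0 T))
    {t : ℝ} (ht : t ∈ I) (hs1 : H.ux 0 t = S.s 1) (hsN : H.ux 1 t = S.s S.N)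
    (hpde : ∀ ξ ∈ Icc (0 : ℝ) 1, H.ut ξ t = M (H.ux ξ t) * H.uxx ξ t)
    (hL : ∀ p q, |p| ≤ R → |q| ≤ R → |M p - M q| ≤ L * |p - q|)
    (hL0 : 0 ≤ L) (hQ0 : 0 ≤ Q)
    (hs : ∀ i ≤ S.N + 1, |S.s i| ≤ R) (hjump : ∀ i ≤ S.N, |S.s (i + 1) - S.s i| ≤ m)
    (hm : 0 < m) (hNc : (S.N : ℝ) ≤ c / m)
    (hμM : ∀ k < S.N, |μ k - M (S.s (k + 1))| ≤ Q * m)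
    (hv : ∀ k < S.N, S.v (k + 1) t * (S.x (k + 1) t - S.x k t) =
      μ k * (halfJump S.N S.s (k + 1) + halfJump S.N S.s k)) :
    ∃ A', HasDerivAt (fun τ => ∫ ξ in (0 : ℝ)..1, (H.u ξ τ - um ξ τ)) A' t ∧
      |A'| ≤ c * (Q + L) * m := by
  have h0 : (0 : ℝ) ∈ Icc (0 : ℝ) 1 := ⟨le_rfl, zero_le_one⟩
  have h1 : (1 : ℝ) ∈ Icc (0 : ℝ) 1 := ⟨zero_le_one, le_rfl⟩
  have d := (hasDerivAt_integral_of_continuousOn H.hut H.hcont_u H.hcont_ut (hIT ht) h1).fun_sub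
    (S.hasDerivAt_integral_um hI ht)
  refine ⟨_, d.congr_of_eventuallyEq ?_, ?_⟩
  · filter_upwards [hI.mem_nhds ht] with τ hτ
    have hτI := Ioo_subset_Icc_self (hIT hτ)
    rw [intervalIntegral.integral_sub (C3Sol.intervalIntegrable_slice H.hcont_u hτI h0 h1)
      (C3Sol.intervalIntegrable_slice hum hτI h0 h1)]
    congr 1
    refine intervalIntegral.integral_congr fun ξ hξ => ?_
    rw [uIcc_of_le zero_le_one] at hξ
    exact (hlink τ hτ ξ hξ).symm
  · rw [abs_sub_comm, H.integral_ut hM (Ioo_subset_Icc_self (hIT ht)) hpde, hs1, hsN,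
      Finset.sum_congr rfl fun k hk => hv k (Finset.mem_range.1 hk)]
    exact abs_sum_mul_jump_sub_integral_le hM S.hN hL0 hm hNc hL hQ0 hs hjump hμM

end CrystSol

/-- A function whose oscillation is controlled satisfies an `L²` bound through its mean. -/
lemma integral_sq_le_of_osc {z : ℝ → ℝ} {F : ℝ} (hz : ContinuousOn z (Icc 0 1))
    (hosc : ∀ x ∈ Icc (0 : ℝ) 1, ∀ y ∈ Icc (0 : ℝ) 1, (z y - z x) ^ 2 ≤ F) :
    ∫ ξ in (0 : ℝ)..1, z ξ ^ 2 ≤ 2 * (∫ ξ in (0 : ℝ)..1, z ξ) ^ 2 + 2 * F := by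
  have hu : uIcc (0 : ℝ) 1 = Icc 0 1 := uIcc_of_le zero_le_one
  have iz : IntervalIntegrable z volume 0 1 := ContinuousOn.intervalIntegrable (by rwa [hu])
  have iz2 : IntervalIntegrable (fun ξ => z ξ ^ 2) volume 0 1 :=
    ContinuousOn.intervalIntegrable (by rw [hu]; exact hz.pow 2)
  set A := ∫ ξ in (0 : ℝ)..1, z ξ with hA
  have hpt : ∀ x ∈ Icc (0 : ℝ) 1, z x ^ 2 ≤ 2 * A ^ 2 + 2 * F := by
    intro x hx
    have hF0 : 0 ≤ F := (sq_nonneg _).trans (hosc x hx x hx)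
    have h1 : |∫ ξ in (0 : ℝ)..1, (z ξ - z x)| ≤ Real.sqrt F * |1 - 0| := by
      rw [← Real.norm_eq_abs]
      refine intervalIntegral.norm_integral_le_of_norm_le_const fun ξ hξ => ?_
      have hξ := uIoc_subset_uIcc hξ
      rw [hu] at hξ
      exact Real.abs_le_sqrt (hosc x hx ξ hξ)
    rw [intervalIntegral.integral_sub iz intervalIntegrable_const,
      intervalIntegral.integral_const, ← hA, sub_zero, abs_one, one_smul, mul_one] at h1
    have h2 : (A - z x) ^ 2 ≤ F := by
      rw [← Real.sq_sqrt hF0]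
      exact sq_le_sq' (abs_le.1 h1).1 (abs_le.1 h1).2
    nlinarith [sq_nonneg (2 * A - z x)]
  have := intervalIntegral.integral_mono_on zero_le_one iz2
    (intervalIntegrable_const (c := 2 * A ^ 2 + 2 * F)) hpt
  simpa using this

lemma integral_sq_le_sq_of_abs_le {f : ℝ → ℝ} {m : ℝ}
    (h : ∀ ξ ∈ Icc (0 : ℝ) 1, |f ξ| ≤ m) : ∫ ξ in (0 : ℝ)..1, f ξ ^ 2 ≤ m ^ 2 := by
  have := intervalIntegral.norm_integral_le_of_norm_le_const (a := (0 : ℝ)) (b := 1)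
    (f := fun ξ => f ξ ^ 2) (C := m ^ 2) fun ξ hξ => by
      rw [uIoc_of_le zero_le_one] at hξ
      have := h ξ (Ioc_subset_Icc_self hξ)
      rw [Real.norm_eq_abs, abs_of_nonneg (sq_nonneg _)]
      exact sq_le_sq' (abs_le.1 this).1 (abs_le.1 this).2
  rw [sub_zero, abs_one, mul_one] at this
  exact (le_abs_self _).trans this

/-- Gronwall's inequality for a continuous function that is differentiable off a partition. -/
lemma piecewise_gronwall {T : ℝ} {J : ℕ} {part : ℕ → ℝ} {F : ℝ → ℝ} {C₁ E : ℝ}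
    (h0 : part 0 = 0) (hJ : part J = T) (hpart : ∀ j, j < J → part j < part (j + 1))
    (hF : ContinuousOn F (Icc 0 T)) (hC₁ : 0 ≤ C₁) (hE : 0 ≤ E) (hF0 : 0 ≤ F 0)
    (hd : ∀ j, j < J → ∀ t ∈ Ioo (part j) (part (j + 1)),
      ∃ F', HasDerivAt F F' t ∧ F' ≤ C₁ * F t + E) :
    ∀ t ∈ Icc 0 T, F t ≤ Real.exp (C₁ * T) * (F 0 + E * T) := by
  intro t ht
  have := le_initial_of_piecewise_deriv_nonpos h0 hJ hpart
    (f := fun t => Real.exp (-(C₁ * t)) * F t - E * t)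
    (((show Continuous fun t => Real.exp (-(C₁ * t)) by fun_prop).continuousOn.mul hF).sub
      (by fun_prop)) ?_ t ht
  · simp only [mul_zero, neg_zero, Real.exp_zero, one_mul, sub_zero] at this
    have h1 : Real.exp (-(C₁ * t)) * F t ≤ F 0 + E * T := by
      linarith [mul_le_mul_of_nonneg_left ht.2 hE]
    have h2 : F t ≤ Real.exp (C₁ * t) * (F 0 + E * T) := by
      have := mul_le_mul_of_nonneg_left h1 (Real.exp_pos (C₁ * t)).le
      rwa [← mul_assoc, ← Real.exp_add, add_neg_cancel, Real.exp_zero, one_mul] at this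
    have hT0 : 0 ≤ T := ht.1.trans ht.2
    exact h2.trans (mul_le_mul_of_nonneg_right
      (Real.exp_le_exp.2 (mul_le_mul_of_nonneg_left ht.2 hC₁)) (by positivity))
  · intro j hj t ht
    obtain ⟨F', hF', hle⟩ := hd j hj t ht
    have ht0 : 0 ≤ t :=
      (h0 ▸ partition_le hpart (Nat.zero_le j) hj.le : (0 : ℝ) ≤ part j).trans ht.1.le
    have de : HasDerivAt (fun t => Real.exp (-(C₁ * t))) (Real.exp (-(C₁ * t)) * -(C₁ * 1)) t :=
      ((hasDerivAt_id' t).const_mul C₁).fun_neg.exp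
    refine ⟨_, (de.fun_mul hF').fun_sub ((hasDerivAt_id' t).const_mul E), ?_⟩
    have he : Real.exp (-(C₁ * t)) ≤ 1 := Real.exp_le_one_iff.2 (by nlinarith)
    have h1 := mul_le_mul_of_nonneg_left hle (Real.exp_pos (-(C₁ * t))).le
    nlinarith [mul_le_mul_of_nonneg_right he hE]

lemma C3Sol.exists_bound {T : ℝ} (H : C3Sol T) : ∃ B, 0 ≤ B ∧ ∀ ξ ∈ Icc (0 : ℝ) 1,
    ∀ t ∈ Icc 0 T, |H.ux ξ t| ≤ B ∧ |H.uxx ξ t| ≤ B ∧ |H.uxt ξ t| ≤ B := by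
  have hK : IsCompact (Icc (0 : ℝ) 1 ×ˢ Icc 0 T) := isCompact_Icc.prod isCompact_Icc
  obtain ⟨B₁, h₁⟩ := hK.exists_bound_of_continuousOn H.hcont_ux
  obtain ⟨B₂, h₂⟩ := hK.exists_bound_of_continuousOn H.hcont_uxx
  obtain ⟨B₃, h₃⟩ := hK.exists_bound_of_continuousOn H.hcont_uxt
  refine ⟨max 0 (max B₁ (max B₂ B₃)), le_max_left _ _, fun ξ hξ t ht => ⟨?_, ?_, ?_⟩⟩
  · exact (h₁ (ξ, t) ⟨hξ, ht⟩).trans (by simp)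
  · exact (h₂ (ξ, t) ⟨hξ, ht⟩).trans (by simp)
  · exact (h₃ (ξ, t) ⟨hξ, ht⟩).trans (by simp)

lemma exists_pos_forall_abs_le {f : ℝ → ℝ} (hf : Continuous f) (hpos : ∀ y, 0 < f y) {R : ℝ}
    (hR : 0 ≤ R) : ∃ lam, 0 < lam ∧ ∀ p, |p| ≤ R → lam ≤ f p := by
  obtain ⟨y, -, hy⟩ := (isCompact_Icc (a := -R) (b := R)).exists_isMinOn
    ⟨0, by linarith, hR⟩ hf.continuousOn
  exact ⟨f y, hpos y, fun p hp => hy (abs_le.1 hp)⟩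

lemma CrystSol.exists_face_coeff {I : Set ℝ} (S : CrystSol I) {W : ℝ → ℝ} (hW : ContDiff ℝ 3 W)
    {K lam L m : ℝ} (hm : 0 < m) (hlam0 : 0 < lam)
    (hlam : ∀ p, |p| ≤ K → lam ≤ iteratedDeriv 2 W p)
    (hL : ∀ p q, |p| ≤ K → |q| ≤ K → |iteratedDeriv 2 W p - iteratedDeriv 2 W q| ≤ L * |p - q|)
    (hL0 : 0 ≤ L) (hs : ∀ i ≤ S.N + 1, |S.s i| ≤ K) (hjump : ∀ i ≤ S.N, |S.s (i + 1) - S.s i| ≤ m)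
    (hmono : ∀ i, 2 ≤ i → i ≤ S.N - 1 → S.s (i - 1) ≠ S.s (i + 1) →
      S.s i ∈ Ioo (min (S.s (i - 1)) (S.s (i + 1))) (max (S.s (i - 1)) (S.s (i + 1))))
    (hfirst : S.s 1 ∈ Ioo (min (S.s 0) (S.s 2)) (max (S.s 0) (S.s 2)))
    (hlast : S.s S.N ∈ Ioo (min (S.s (S.N - 1)) (S.s (S.N + 1)))
      (max (S.s (S.N - 1)) (S.s (S.N + 1))))
    (hvel : ∀ t ∈ I, ∀ i, 1 ≤ i → i ≤ S.N → S.v i t = Real.sqrt (1 + (S.s i) ^ 2) *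
      secondDD W S.s i * boundaryFactor S.N S.s i / S.len i t) :
    ∃ μ : ℕ → ℝ, (∀ k < S.N, lam ≤ μ k) ∧
      (∀ k < S.N, |μ k - mobility W (S.s (k + 1))| ≤ Real.sqrt (1 + K ^ 2) * L * m) ∧
      ∀ t ∈ I, ∀ k < S.N, S.v (k + 1) t * (S.x (k + 1) t - S.x k t) =
        μ k * (halfJump S.N S.s (k + 1) + halfJump S.N S.s k) := by
  have h := fun k (hk : k < S.N) => exists_secondDD_mul_boundaryFactor_eq hW S.hN hm hlam hL hL0
    hs hjump hmono hfirst hlast hk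
  choose! ω hω hωW e using h
  refine ⟨fun k => Real.sqrt (1 + S.s (k + 1) ^ 2) * ω k,
    fun k hk => le_sqrt_one_add_sq_mul hlam0 (hω k hk),
    fun k hk => abs_mobility_coeff_sub_le (hs _ (by omega)) (hωW k hk), fun t ht k hk => ?_⟩
  have hl : S.x (k + 1) t - S.x k t ≠ 0 := (sub_pos.2 (S.hmono t ht k hk)).ne'
  rw [hvel t ht (k + 1) (by omega) hk, len, Nat.add_sub_cancel, div_mul_cancel₀ _ hl, mul_assoc,
    e k hk]
  ring

/-- A pointwise inequality between continuous functions on the open pieces of a partition extends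
to the whole interval. -/
lemma le_of_piecewise_le {T : ℝ} {J : ℕ} {part : ℕ → ℝ} {f g : ℝ → ℝ} (h0 : part 0 = 0)
    (hJ1 : 1 ≤ J) (hJ : part J = T) (hpart : ∀ j, j < J → part j < part (j + 1))
    (hf : ContinuousOn f (Icc 0 T)) (hg : ContinuousOn g (Icc 0 T))
    (h : ∀ j, j < J → ∀ t ∈ Ioo (part j) (part (j + 1)), f t ≤ g t) :
    ∀ t ∈ Icc 0 T, f t ≤ g t := by
  intro t ht
  obtain ⟨j, hj, htj⟩ := exists_mem_closure_piece h0 hJ hJ1 ht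
  have hsub : Icc (part j) (part (j + 1)) ⊆ Icc 0 T :=
    Icc_subset_Icc (h0 ▸ partition_le hpart (Nat.zero_le j) hj.le)
      (hJ ▸ partition_le hpart hj le_rfl)
  have hcl := closure_Ioo (hpart j hj).ne
  exact le_on_closure (h j hj) (hcl ▸ hf.mono hsub) (hcl ▸ hg.mono hsub) (hcl ▸ htj)

/-- A continuous function whose derivative is bounded by `D` off a partition moves with speed at
most `D`. -/
lemma abs_le_of_piecewise_deriv_le {T : ℝ} {J : ℕ} {part : ℕ → ℝ} {A : ℝ → ℝ} {D : ℝ}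
    (h0 : part 0 = 0) (hJ : part J = T) (hpart : ∀ j, j < J → part j < part (j + 1))
    (hA : ContinuousOn A (Icc 0 T)) (hd : ∀ j, j < J → ∀ t ∈ Ioo (part j) (part (j + 1)),
      ∃ A', HasDerivAt A A' t ∧ |A'| ≤ D) :
    ∀ t ∈ Icc 0 T, |A t| ≤ |A 0| + D * t := by
  intro t ht
  have hlin : ∀ t, HasDerivAt (fun t => D * t) (D * 1) t := fun t =>
    (hasDerivAt_id' t).const_mul D
  have h1 := le_initial_of_piecewise_deriv_nonpos h0 hJ hpart (f := fun t => A t - D * t)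
    (hA.sub (by fun_prop)) (fun j hj τ hτ => by
      obtain ⟨A', hA', hle⟩ := hd j hj τ hτ
      exact ⟨_, hA'.fun_sub (hlin τ), by linarith [le_abs_self A']⟩) t ht
  have h2 := le_initial_of_piecewise_deriv_nonpos h0 hJ hpart (f := fun t => -A t - D * t)
    (hA.neg.sub (by fun_prop)) (fun j hj τ hτ => by
      obtain ⟨A', hA', hle⟩ := hd j hj τ hτ
      exact ⟨_, hA'.fun_neg.fun_sub (hlin τ), by linarith [neg_abs_le A']⟩) t ht
  simp only [mul_zero, sub_zero] at h1 h2
  exact abs_le.2 ⟨by linarith [neg_le_abs (A 0)], by linarith [le_abs_self (A 0)]⟩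

/-- `H¹` convergence with rate `m^(1/2)` of the crystalline algorithm for motion of a
graph by weighted curvature with constant Neumann boundary conditions
`u_x(0,t) = a`, `u_x(1,t) = b`. -/
theorem weighted_curvature_neumann_H1_convergence (W : ℝ → ℝ) (hW : ContDiff ℝ 3 W)
    (hWpp : ∀ y : ℝ, 0 < iteratedDeriv 2 W y)
    (a b K c T : ℝ) (hK : 0 < K) (hc : 0 < c) (hT : 0 < T) (H : C3Sol T)
    (hpde : ∀ ξ ∈ Set.Icc (0:ℝ) 1, ∀ t ∈ Set.Icc (0:ℝ) T,
      H.ut ξ t = Real.sqrt (1 + (H.ux ξ t) ^ 2) * iteratedDeriv 2 W (H.ux ξ t) * H.uxx ξ t)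
    (hbc0 : ∀ t ∈ Set.Icc (0:ℝ) T, H.ux 0 t = a)
    (hbc1 : ∀ t ∈ Set.Icc (0:ℝ) T, H.ux 1 t = b) :
    ∃ m₀ : ℝ, 0 < m₀ ∧ ∃ C : ℝ, 0 < C ∧
      ∀ m : ℝ, 0 < m → m ≤ m₀ →
      ∀ um uxm : ℝ → ℝ → ℝ, ∀ J : ℕ, ∀ part : ℕ → ℝ,
      ContinuousOn (fun q : ℝ × ℝ => um q.1 q.2) (Set.Icc 0 1 ×ˢ Set.Icc 0 T) →
      ContinuousOn (fun t => ∫ ξ in (0:ℝ)..1, (H.ux ξ t - uxm ξ t) ^ 2) (Set.Icc 0 T) →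
      1 ≤ J → part 0 = 0 → part J = T → (∀ j, j < J → part j < part (j + 1)) →
      (∀ j, j < J → ∃ S : CrystSol (Set.Ioo (part j) (part (j + 1))),
        UmLink S um ∧ SlopeLink S uxm ∧
        (S.N : ℝ) ≤ c / m ∧
        S.s 1 = a ∧ S.s S.N = b ∧
        (∀ i ≤ S.N + 1, |S.s i| ≤ K) ∧
        (∀ i ≤ S.N, |S.s (i + 1) - S.s i| ≤ m) ∧
        (∀ i, 2 ≤ i → i ≤ S.N - 1 → S.s (i - 1) ≠ S.s (i + 1) →
          S.s i ∈ Set.Ioo (min (S.s (i - 1)) (S.s (i + 1)))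
            (max (S.s (i - 1)) (S.s (i + 1)))) ∧
        S.s 1 ∈ Set.Ioo (min (S.s 0) (S.s 2)) (max (S.s 0) (S.s 2)) ∧
        S.s S.N ∈ Set.Ioo (min (S.s (S.N - 1)) (S.s (S.N + 1)))
          (max (S.s (S.N - 1)) (S.s (S.N + 1))) ∧
        (∀ t ∈ Set.Ioo (part j) (part (j + 1)), ∀ i, 1 ≤ i → i ≤ S.N →
          S.v i t = Real.sqrt (1 + (S.s i) ^ 2) * secondDD W S.s i *
            (if i = 1 then (S.s 2 - S.s 1) / (S.s 2 - S.s 0)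
             else if i = S.N then
               (S.s S.N - S.s (S.N - 1)) / (S.s (S.N + 1) - S.s (S.N - 1))
             else 1) / S.len i t)) →
      (∀ ξ ∈ Set.Icc (0:ℝ) 1, |uxm ξ 0 - H.ux ξ 0| ≤ m) →
      um 0 0 = H.u 0 0 →
      ∀ t ∈ Set.Icc (0:ℝ) T,
        Real.sqrt ((∫ ξ in (0:ℝ)..1, (H.u ξ t - um ξ t) ^ 2) +
            ∫ ξ in (0:ℝ)..1, (H.ux ξ t - uxm ξ t) ^ 2) ≤
          C * Real.sqrt m := by
  obtain ⟨B, hB0, hB⟩ := H.exists_bound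
  set R := max K B
  have hR0 : 0 ≤ R := hB0.trans (le_max_right _ _)
  obtain ⟨lam, hlam0, hlam⟩ := exists_pos_forall_abs_le
    (contDiff_iteratedDeriv_two hW).continuous hWpp hR0
  obtain ⟨L, hL0, hL⟩ := exists_lipschitz_bound (contDiff_iteratedDeriv_two hW) R
  obtain ⟨L', hL'0, hL'⟩ := exists_lipschitz_bound (contDiff_mobility hW) R
  set Q := Real.sqrt (1 + R ^ 2) * L
  have hQ0 : 0 ≤ Q := by positivity
  set C₁ := B ^ 2 / lam * L' ^ 2
  set C₂ := B ^ 2 / lam * Q ^ 2 + 2 * B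
  set D := c * (Q + L')
  have hC₁0 : 0 ≤ C₁ := by positivity
  have hC₂0 : 0 ≤ C₂ := by positivity
  have hD0 : 0 ≤ D := by positivity
  set CF := Real.exp (C₁ * T) * (1 + C₂ * T)
  have hCF0 : 0 < CF := by positivity
  refine ⟨1, one_pos, Real.sqrt (2 * (1 + D * T) ^ 2 + 3 * CF), by positivity, ?_⟩
  intro m hm hm1 um uxm J part hum hF hJ1 h0 hJ hpart hS hux0 hum0
  have hmm : m ^ 2 ≤ m := by nlinarith
  have hI0 : (0 : ℝ) ∈ Icc (0 : ℝ) 1 := ⟨le_rfl, zero_le_one⟩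
  have hT0 : (0 : ℝ) ∈ Icc (0 : ℝ) T := ⟨le_rfl, hT.le⟩
  set F : ℝ → ℝ := fun t => ∫ ξ in (0 : ℝ)..1, (H.ux ξ t - uxm ξ t) ^ 2
  have hz : ContinuousOn (fun q : ℝ × ℝ => H.u q.1 q.2 - um q.1 q.2) (Icc 0 1 ×ˢ Icc 0 T) :=
    H.hcont_u.sub hum
  have hpieces : ∀ j, j < J → ∀ t ∈ Ioo (part j) (part (j + 1)),
      (∃ F', HasDerivAt F F' t ∧ F' ≤ C₁ * F t + C₂ * m) ∧
      (∃ A', HasDerivAt (fun τ => ∫ ξ in (0 : ℝ)..1, (H.u ξ τ - um ξ τ)) A' t ∧ |A'| ≤ D * m) ∧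
      ∀ x ∈ Icc (0 : ℝ) 1, ∀ y ∈ Icc (0 : ℝ) 1,
        ((H.u y t - um y t) - (H.u x t - um x t)) ^ 2 ≤ F t := by
    intro j hj t ht
    obtain ⟨S, hlu, hlx, hNc, hs1, hsN, hsK, hjump, hmono, hfirst, hlast, hvel⟩ := hS j hj
    have hIT : Ioo (part j) (part (j + 1)) ⊆ Ioo 0 T :=
      Ioo_subset_Ioo (h0 ▸ partition_le hpart (Nat.zero_le j) hj.le)
        (hJ ▸ partition_le hpart hj le_rfl)
    have htI := Ioo_subset_Icc_self (hIT ht)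
    have hs : ∀ i ≤ S.N + 1, |S.s i| ≤ R := fun i hi => (hsK i hi).trans (le_max_left _ _)
    obtain ⟨μ, hμ, hμM, hv⟩ := S.exists_face_coeff hW hm hlam0 hlam hL hL0 hs hjump hmono hfirst
      hlast hvel
    have e1 : H.ux 0 t = S.s 1 := (hbc0 t htI).trans hs1.symm
    have eN : H.ux 1 t = S.s S.N := (hbc1 t htI).trans hsN.symm
    have hpde' : ∀ ξ ∈ Icc (0 : ℝ) 1, H.ut ξ t = mobility W (H.ux ξ t) * H.uxx ξ t :=
      fun ξ hξ => hpde ξ hξ t htI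
    refine ⟨S.exists_slope_energy_deriv_le H isOpen_Ioo hIT hlx ht e1 eN hpde' hB0
      (fun ξ hξ => (hB ξ hξ t htI).1.trans (le_max_right _ _)) (fun ξ hξ => (hB ξ hξ t htI).2.1)
      (fun ξ hξ => (hB ξ hξ t htI).2.2) hL' hs hjump hlam0 hm hm1 hμ hμM (hv t ht),
      S.exists_mean_deriv_le H (contDiff_mobility hW).continuous isOpen_Ioo hIT hlu hum ht e1 eN
        hpde' hL' hL'0 hQ0 hs hjump hm hNc hμM (hv t ht), fun x hx y hy => ?_⟩
    rw [← hlu t ht x hx, ← hlu t ht y hy]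
    exact S.sq_sub_le_slope_energy H hlx ht htI
      ((C3Sol.continuousOn_slice hum htI).congr fun ξ hξ => hlu t ht ξ hξ) hx hy
  have hosc : ∀ t ∈ Icc 0 T, ∀ x ∈ Icc (0 : ℝ) 1, ∀ y ∈ Icc (0 : ℝ) 1,
      ((H.u y t - um y t) - (H.u x t - um x t)) ^ 2 ≤ F t := by
    intro t ht x hx y hy
    have hslice : ∀ x ∈ Icc (0 : ℝ) 1, ContinuousOn (fun t => H.u x t - um x t) (Icc 0 T) :=
      fun x hx => hz.comp (f := fun t => (x, t)) (by fun_prop) fun t ht => ⟨hx, ht⟩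
    exact le_of_piecewise_le h0 hJ1 hJ hpart (((hslice y hy).sub (hslice x hx)).pow 2) hF
      (fun j hj t ht => (hpieces j hj t ht).2.2 x hx y hy) t ht
  have hF0 : F 0 ≤ m ^ 2 := integral_sq_le_sq_of_abs_le fun ξ hξ => by
    rw [abs_sub_comm]; exact hux0 ξ hξ
  have hFle : ∀ t ∈ Icc 0 T, F t ≤ CF * m := fun t ht => by
    have hinit : F 0 + C₂ * m * T ≤ (1 + C₂ * T) * m := by linarith
    exact (piecewise_gronwall h0 hJ hpart hF hC₁0 (by positivity)
      ((sq_nonneg _).trans (hosc 0 hT0 0 hI0 0 hI0))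
      (fun j hj t ht => (hpieces j hj t ht).1) t ht).trans
      ((mul_le_mul_of_nonneg_left hinit (Real.exp_pos _).le).trans_eq (mul_assoc _ _ _).symm)
  have hA0 : |∫ ξ in (0 : ℝ)..1, (H.u ξ 0 - um ξ 0)| ≤ m := by
    have := intervalIntegral.norm_integral_le_of_norm_le_const (a := (0 : ℝ)) (b := 1)
      (f := fun ξ => H.u ξ 0 - um ξ 0) (C := m) fun ξ hξ => by
        rw [uIoc_of_le zero_le_one] at hξ
        have := (hosc 0 hT0 0 hI0 ξ (Ioc_subset_Icc_self hξ)).trans hF0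
        rw [hum0, sub_self, sub_zero] at this
        exact abs_le_of_sq_le_sq this hm.le
    rwa [sub_zero, abs_one, mul_one] at this
  intro t ht
  have hA := (abs_le_of_piecewise_deriv_le h0 hJ hpart (continuousOn_integral_of_continuousOn hz)
    (fun j hj t ht => (hpieces j hj t ht).2.1) t ht).trans
    (add_le_add hA0 (mul_le_mul_of_nonneg_left ht.2 (by positivity)))
  have hA2 := sq_le_sq' (abs_le.1 hA).1 (abs_le.1 hA).2
  have hz2 := integral_sq_le_of_osc (z := fun ξ => H.u ξ t - um ξ t)
    (C3Sol.continuousOn_slice (f := fun ξ t => H.u ξ t - um ξ t) hz ht) (hosc t ht)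
  rw [← Real.sqrt_mul (by positivity)]
  refine Real.sqrt_le_sqrt ?_
  have hm2 := mul_le_mul_of_nonneg_left hmm (sq_nonneg (1 + D * T))
  have := hFle t ht
  have e : (m + D * m * T) ^ 2 = (1 + D * T) ^ 2 * m ^ 2 := by ring
  linarith
end

section
/- Let f : ℝ → ℝ be three times continuously differentiable. For p ∈ ℝ define θ(p) = arccos(−p/√(1+p²)) ∈ (0,π) and W(p) = √(1+p²) · f(θ(p)). Then W is three times continuously differentiable and for every p ∈ ℝ, W'''(p) = ( −3p·f(θ(p)) + f'(θ(p)) − 3p·f''(θ(p)) + f'''(θ(p)) ) / (1+p²)^{5/2}. -/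
open Real in
theorem Real.arccos_neg_div_sqrt_one_add_sq (p : ℝ) :
    arccos (-p / √(1 + p ^ 2)) = π / 2 + arctan p := by
  rw [arccos, neg_div, arcsin_neg, ← arctan_eq_arcsin, sub_neg_eq_add]

theorem Real.hasDerivAt_sqrt_one_add_sq (p : ℝ) :
    HasDerivAt (fun p : ℝ => √(1 + p ^ 2)) (p / √(1 + p ^ 2)) p := by
  have h : HasDerivAt (fun p : ℝ => 1 + p ^ 2) (2 * p) p := by
    simpa using (hasDerivAt_pow 2 p).const_add 1
  convert h.sqrt (by positivity) using 1
  field_simp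

/-- If `f` is the interfacial energy as a function of the normal angle
`θ(p) = arccos(-p/√(1+p²))` and `W(p) = √(1+p²) f(θ(p))`, then `W` is `C³` and
`W'''(p) = (-3p f(θ(p)) + f'(θ(p)) - 3p f''(θ(p)) + f'''(θ(p))) / (1+p²)^{5/2}`. -/
theorem energy_density_third_deriv (f θ W : ℝ → ℝ) (hf : ContDiff ℝ 3 f)
    (hθ : ∀ p : ℝ, θ p = Real.arccos (-p / Real.sqrt (1 + p ^ 2)))
    (hW : ∀ p : ℝ, W p = Real.sqrt (1 + p ^ 2) * f (θ p)) :
    ContDiff ℝ 3 W ∧ ∀ p : ℝ,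
      iteratedDeriv 3 W p =
        (-3 * p * f (θ p) + deriv f (θ p) - 3 * p * iteratedDeriv 2 f (θ p) +
          iteratedDeriv 3 f (θ p)) / (1 + p ^ 2) ^ ((5 : ℝ) / 2) := by
  obtain rfl : θ = fun p => Real.pi / 2 + Real.arctan p :=
    funext fun p => (hθ p).trans (Real.arccos_neg_div_sqrt_one_add_sq p)
  obtain rfl : W = fun p => √(1 + p ^ 2) * f (Real.pi / 2 + Real.arctan p) := funext hW
  have hs : ∀ p : ℝ, √(1 + p ^ 2) ≠ 0 := fun p => by positivity
  have hsq : ∀ p : ℝ, √(1 + p ^ 2) ^ 2 = 1 + p ^ 2 := fun p => Real.sq_sqrt (by positivity)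
  constructor
  · refine ContDiff.mul (ContDiff.sqrt (by fun_prop) fun p => by positivity) ?_
    exact hf.comp (contDiff_const.add Real.contDiff_arctan)
  have hcomp : ∀ k < 3, ∀ p : ℝ,
      HasDerivAt (fun p => iteratedDeriv k f (Real.pi / 2 + Real.arctan p))
        (iteratedDeriv (k + 1) f (Real.pi / 2 + Real.arctan p) * (1 / √(1 + p ^ 2) ^ 2)) p := by
    intro k hk p
    have hd := (hf.differentiable_iteratedDeriv k (by exact_mod_cast hk)
      (Real.pi / 2 + Real.arctan p)).hasDerivAt
    rw [← iteratedDeriv_succ] at hd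
    rw [hsq]
    exact hd.comp p ((Real.hasDerivAt_arctan p).const_add _)
  have h1 : deriv (fun p => √(1 + p ^ 2) * f (Real.pi / 2 + Real.arctan p)) = fun p =>
      p / √(1 + p ^ 2) * iteratedDeriv 0 f (Real.pi / 2 + Real.arctan p) +
        iteratedDeriv 1 f (Real.pi / 2 + Real.arctan p) / √(1 + p ^ 2) := by
    funext p
    have h := (Real.hasDerivAt_sqrt_one_add_sq p).mul (hcomp 0 (by norm_num) p)
    simp only [iteratedDeriv_zero] at h ⊢
    refine (h.congr_deriv ?_).deriv
    have := hs p
    field_simp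
  have h2 : deriv (fun p => p / √(1 + p ^ 2) * iteratedDeriv 0 f (Real.pi / 2 + Real.arctan p) +
        iteratedDeriv 1 f (Real.pi / 2 + Real.arctan p) / √(1 + p ^ 2)) = fun p =>
      (iteratedDeriv 0 f (Real.pi / 2 + Real.arctan p) +
        iteratedDeriv 2 f (Real.pi / 2 + Real.arctan p)) / √(1 + p ^ 2) ^ 3 := by
    funext p
    have h := (((hasDerivAt_id p).div (Real.hasDerivAt_sqrt_one_add_sq p) (hs p)).mul
      (hcomp 0 (by norm_num) p)).add
      ((hcomp 1 (by norm_num) p).div (Real.hasDerivAt_sqrt_one_add_sq p) (hs p))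
    refine (h.congr_deriv ?_).deriv
    have hs_p := hs p
    have hsq_p := hsq p
    simp only [id, zero_add, Nat.reduceAdd, Pi.div_apply]
    clear h
    generalize √(1 + p ^ 2) = s at hs_p hsq_p ⊢
    generalize Real.pi / 2 + Real.arctan p = t
    field_simp
    linear_combination iteratedDeriv 0 f t * hsq_p
  intro p
  have h := ((hcomp 0 (by norm_num) p).add (hcomp 2 (by norm_num) p)).div
    ((Real.hasDerivAt_sqrt_one_add_sq p).pow 3) (pow_ne_zero 3 (hs p))
  have hpow : (1 + p ^ 2) ^ ((5 : ℝ) / 2) = √(1 + p ^ 2) ^ 5 := by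
    rw [Real.sqrt_eq_rpow, ← Real.rpow_mul_natCast (by positivity)]
    norm_num
  rw [iteratedDeriv_succ', iteratedDeriv_succ', iteratedDeriv_one, h1, h2, hpow]
  refine (h.congr_deriv ?_).deriv
  have := hs p
  simp only [iteratedDeriv_zero, zero_add, Nat.reduceAdd, iteratedDeriv_one, Pi.add_apply,
    Pi.pow_apply]
  generalize Real.pi / 2 + Real.arctan p = t
  field_simp
  ring
end

section
/- Let 0 < θ₁ < θ₂ < θ₃ < π and let f₁, f₂, f₃ be real numbers. Set s_j = −cot θ_j for j = 1, 2, 3 (so s₁ < s₂ < s₃), w_j = f_j / sin θ_j, and let L > 0 with l = L sin θ₂. Then [ (w₃ − w₂)/(s₃ − s₂) − (w₂ − w₁)/(s₂ − s₁) ] / l = (1/L) [ f₁ / sin(θ₂ − θ₁) − f₂ ( cot(θ₂ − θ₁) + cot(θ₃ − θ₂) ) + f₃ / sin(θ₃ − θ₂) ]. -/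
/-- The divided difference of `f / sin` with respect to the slope `-cot`. -/
theorem divided_difference_neg_cot {a b : ℝ} (ha : Real.sin a ≠ 0) (hb : Real.sin b ≠ 0)
    (hab : Real.sin (b - a) ≠ 0) (f g : ℝ) :
    (g / Real.sin b - f / Real.sin a) /
        (-(Real.cos b / Real.sin b) - -(Real.cos a / Real.sin a)) =
      (g * Real.sin a - f * Real.sin b) / Real.sin (b - a) := by
  have hslope : -(Real.cos b / Real.sin b) - -(Real.cos a / Real.sin a) =
      Real.sin (b - a) / (Real.sin a * Real.sin b) := by
    rw [Real.sin_sub]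
    field_simp
    ring
  rw [hslope]
  field_simp


/-- Equivalence of the graph form and the Angenent–Gurtin form of the crystalline face
velocity: for three consecutive faces with normal angles `0 < θ₁ < θ₂ < θ₃ < π`, energies
`f_j`, slopes `s_j = -cot θ_j`, energy densities `w_j = f_j / sin θ_j`, middle face length
`L` and horizontal projection `l = L sin θ₂`, the divided-difference velocity `Δ/l` equals
the Angenent–Gurtin face-velocity formula. -/
theorem crystalline_velocity_formula (θ₁ θ₂ θ₃ : ℝ)
    (h1 : 0 < θ₁) (h12 : θ₁ < θ₂) (h23 : θ₂ < θ₃) (h3 : θ₃ < Real.pi)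
    (f₁ f₂ f₃ L l s₁ s₂ s₃ w₁ w₂ w₃ : ℝ) (hL : 0 < L) (hl : l = L * Real.sin θ₂)
    (hs₁ : s₁ = -(Real.cos θ₁ / Real.sin θ₁))
    (hs₂ : s₂ = -(Real.cos θ₂ / Real.sin θ₂))
    (hs₃ : s₃ = -(Real.cos θ₃ / Real.sin θ₃))
    (hw₁ : w₁ = f₁ / Real.sin θ₁) (hw₂ : w₂ = f₂ / Real.sin θ₂) (hw₃ : w₃ = f₃ / Real.sin θ₃) :
    ((w₃ - w₂) / (s₃ - s₂) - (w₂ - w₁) / (s₂ - s₁)) / l =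
      (1 / L) * (f₁ / Real.sin (θ₂ - θ₁)
        - f₂ * (Real.cos (θ₂ - θ₁) / Real.sin (θ₂ - θ₁)
            + Real.cos (θ₃ - θ₂) / Real.sin (θ₃ - θ₂))
        + f₃ / Real.sin (θ₃ - θ₂)) := by
  subst hl hs₁ hs₂ hs₃ hw₁ hw₂ hw₃
  have sin₁ : Real.sin θ₁ ≠ 0 := (Real.sin_pos_of_pos_of_lt_pi h1 (by linarith)).ne'
  have sin₂ : Real.sin θ₂ ≠ 0 :=
    (Real.sin_pos_of_pos_of_lt_pi (by linarith) (by linarith)).ne'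
  have sin₃ : Real.sin θ₃ ≠ 0 := (Real.sin_pos_of_pos_of_lt_pi (by linarith) h3).ne'
  have sin₁₂ : Real.sin (θ₂ - θ₁) ≠ 0 :=
    (Real.sin_pos_of_pos_of_lt_pi (by linarith) (by linarith)).ne'
  have sin₂₃ : Real.sin (θ₃ - θ₂) ≠ 0 :=
    (Real.sin_pos_of_pos_of_lt_pi (by linarith) (by linarith)).ne'
  rw [divided_difference_neg_cot sin₂ sin₃ sin₂₃, divided_difference_neg_cot sin₁ sin₂ sin₁₂]
  have expand₁ : Real.sin θ₁ =
      Real.sin θ₂ * Real.cos (θ₂ - θ₁) - Real.cos θ₂ * Real.sin (θ₂ - θ₁) := by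
    rw [← Real.sin_sub, sub_sub_cancel]
  have expand₃ : Real.sin θ₃ =
      Real.sin θ₂ * Real.cos (θ₃ - θ₂) + Real.cos θ₂ * Real.sin (θ₃ - θ₂) := by
    rw [← Real.sin_add, add_sub_cancel]
  rw [expand₁, expand₃]
  field_simp
  ring
end

section
/- Let W : ℝ → ℝ be strictly convex and let u^m be a crystalline discrete solution at a time t, with N ≥ 4 faces, whose face velocities satisfy v_j = √(1+s_j²) Δ_j / l_j for 2 ≤ j ≤ N−1, and such that for every 2 ≤ j ≤ N−1 with s_{j−1} ≠ s_{j+1} the slope s_j lies strictly between s_{j−1} and s_{j+1}. Suppose 2 ≤ i ≤ N−2 and s_i > s_{i+1} (so the corner x_i(t) is a local maximum of the function u^m(·,t)). Then v_i(t) ≤ 0 and v_{i+1}(t) ≤ 0. (Hence an interior maximum of u^m cannot increase: the maximum principle holds for u^m.) -/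
open Set MeasureTheory

theorem secondDD_nonpos {W : ℝ → ℝ}
    (hconv : ∀ a b c : ℝ, a < b → b < c →
      (W b - W a) / (b - a) < (W c - W b) / (c - b))
    {s : ℕ → ℝ} {j : ℕ}
    (h : s (j - 1) = s (j + 1) ∨ (s (j + 1) < s j ∧ s j < s (j - 1))) :
    secondDD W s j ≤ 0 := by
  unfold secondDD
  rw [← neg_sub (W (s j)) (W (s (j + 1))), ← neg_sub (s j) (s (j + 1)), neg_div_neg_eq]
  rcases h with h | ⟨h1, h2⟩
  · rw [h, sub_self]
  · have := hconv _ _ _ h1 h2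
    rw [← neg_sub (W (s (j - 1))) (W (s j)), ← neg_sub (s (j - 1)) (s j), neg_div_neg_eq]
    linarith

theorem CrystSol.len_pos {I : Set ℝ} (S : CrystSol I) {t : ℝ} (ht : t ∈ I) {j : ℕ}
    (hj : 1 ≤ j) (hjN : j ≤ S.N) : 0 < S.len j t := by
  have := S.hmono t ht (j - 1) (by omega)
  rw [Nat.sub_add_cancel hj] at this
  exact sub_pos.2 this

/-- Maximum principle for `u^m`: if the corner `x_i(t)` is a local maximum of
`u^m(·,t)` (i.e. `s_i > s_{i+1}`) then the velocities of the two adjacent faces are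
nonpositive, so an interior maximum cannot increase. -/
theorem interior_maximum_principle (W : ℝ → ℝ)
    (hconv : ∀ a b c : ℝ, a < b → b < c →
      (W b - W a) / (b - a) < (W c - W b) / (c - b))
    (I : Set ℝ) (S : CrystSol I) (t : ℝ) (ht : t ∈ I) (hN4 : 4 ≤ S.N)
    (hvlaw : ∀ j, 2 ≤ j → j ≤ S.N - 1 →
      S.v j t = Real.sqrt (1 + (S.s j) ^ 2) * secondDD W S.s j / S.len j t)
    (hbetween : ∀ j, 2 ≤ j → j ≤ S.N - 1 → S.s (j - 1) ≠ S.s (j + 1) →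
      S.s j ∈ Set.Ioo (min (S.s (j - 1)) (S.s (j + 1))) (max (S.s (j - 1)) (S.s (j + 1))))
    (i : ℕ) (hi2 : 2 ≤ i) (hiN : i ≤ S.N - 2)
    (hdec : S.s (i + 1) < S.s i) :
    S.v i t ≤ 0 ∧ S.v (i + 1) t ≤ 0 := by
  have key : ∀ j, 2 ≤ j → j ≤ S.N - 1 →
      (S.s (j + 1) < S.s j ∨ S.s j < S.s (j - 1)) → S.v j t ≤ 0 := by
    intro j hj hjN h
    rw [hvlaw j hj hjN]
    refine div_nonpos_of_nonpos_of_nonneg (mul_nonpos_of_nonneg_of_nonpos (Real.sqrt_nonneg _)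
      (secondDD_nonpos hconv ?_)) (S.len_pos ht (by omega) (by omega)).le
    refine or_iff_not_imp_left.2 fun hne => ?_
    obtain ⟨hmin, hmax⟩ := hbetween j hj hjN hne
    rcases min_lt_iff.1 hmin with h1 | h1 <;> rcases lt_max_iff.1 hmax with h2 | h2 <;>
      rcases h with h | h <;> constructor <;> linarith
  exact ⟨key i hi2 (by omega) (Or.inl hdec), key (i + 1) (by omega) (by omega) (Or.inr hdec)⟩
end
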